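/- arXiv:1507.07643 — 3 statements merged into one kernel-verified Lean document; each statement's English description precedes it below -/
import Mathlib

section
/- Let Λ be a directed poset, H = ⋃_{λ∈Λ} H_λ a locally Hilbert space, S a *-semigroup acting on the left on a nonempty set X, and k : X × X → B_loc(H) a kernel. The following are equivalent. (1) k is positive semidefinite, invariant under the action of S (i.e., k(s·x, y) = k(x, s*·y) for all s ∈ S and x, y ∈ X), and satisfies the boundedness condition: for every s ∈ S and λ ∈ Λ there exists c_λ(s) ≥ 0 such that for all n ∈ ℕ, x_1,…,x_n ∈ X and h_1,…,h_n ∈ H_λ, Σ_{i,j=1}^n ⟨k(s·x_i, s·x_j) h_j, h_i⟩ ≤ c_λ(s) · Σ_{i,j=1}^n ⟨k(x_i, x_j) h_j, h_i⟩. (2) There exist a locally Hilbert space K = ⋃_{λ∈Λ} K_λ over the same Λ, a map π : S → B_loc(K) with π(st) = π(s) ∘ π(t) and π(s*) = π(s)* for all s, t ∈ S, and a map V : X → B_loc(H,K) such that k(x,y) = V(x)* ∘ V(y) and V(s·x) = π(s) ∘ V(x) for all s ∈ S and x, y ∈ X. Moreover, in (2) the triple (K; π; V) can be chosen minimal, i.e.,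 such that for every λ ∈ Λ the closed linear span in K_λ of {V(x)h : x ∈ X, h ∈ H_λ} equals K_λ. -/
open scoped InnerProductSpace ComplexOrder

noncomputable section

universe u v w

/-- A locally Hilbert space structure over the directed poset `Λ` on the
inner product space `H`: a monotone family of complete subspaces whose union is `H`. -/
structure LocallyHilbert (Λ : Type v) [PartialOrder Λ] (H : Type u)
    [NormedAddCommGroup H] [InnerProductSpace ℂ H] : Type (max u v) where
  E : Λ → Submodule ℂ H
  mono : Monotone E
  isComplete : ∀ lam : Λ, IsComplete (E lam : Set H)
  exhaustive : ∀ h : H, ∃ lam : Λ, h ∈ E lam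

/-- A bundled locally Hilbert space over `Λ`. -/
structure LocHilbertBundle (Λ : Type v) [PartialOrder Λ] : Type (max (u + 1) v) where
  carrier : Type u
  [ngroup : NormedAddCommGroup carrier]
  [ips : InnerProductSpace ℂ carrier]
  str : LocallyHilbert Λ carrier

attribute [instance] LocHilbertBundle.ngroup LocHilbertBundle.ips

variable {Λ : Type v} [PartialOrder Λ]
variable {H : Type u} [NormedAddCommGroup H] [InnerProductSpace ℂ H]
variable {K : Type w} [NormedAddCommGroup K] [InnerProductSpace ℂ K]

/-- `T : H → K` is a locally bounded operator: it maps each `H_λ` into `K_λ`, boundedly,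
and (equivalently to the usual formulation) the adjoints of its restrictions are
compatible, i.e. for every `k ∈ K_λ` the functional `h ↦ ⟪T h, k⟫` is represented by a
vector of `H_λ`. -/
structure IsLocallyBounded (hH : LocallyHilbert Λ H) (hK : LocallyHilbert Λ K)
    (T : H →ₗ[ℂ] K) : Prop where
  maps_mem : ∀ lam : Λ, ∀ h ∈ hH.E lam, T h ∈ hK.E lam
  bound : ∀ lam : Λ, ∃ C : ℝ, ∀ h ∈ hH.E lam, ‖T h‖ ≤ C * ‖h‖
  adjoint_mem : ∀ lam : Λ, ∀ k ∈ hK.E lam, ∃ v ∈ hH.E lam,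
    ∀ h : H, ⟪T h, k⟫_ℂ = ⟪h, v⟫_ℂ

/-- `S` is the (formal) adjoint of `T`. -/
def IsLAdjoint (T : H →ₗ[ℂ] K) (S : K →ₗ[ℂ] H) : Prop :=
  ∀ (h : H) (k : K), ⟪T h, k⟫_ℂ = ⟪h, S k⟫_ℂ

/-- The operator norm of the restriction of `T` to the submodule `p`. -/
def restNorm (p : Submodule ℂ H) (T : H →ₗ[ℂ] K) : ℝ :=
  sInf {C : ℝ | 0 ≤ C ∧ ∀ h ∈ p, ‖T h‖ ≤ C * ‖h‖}

/-- Positive semidefiniteness of a kernel with values locally bounded operators. -/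
def IsPSDKernel {X : Type*} (k : X → X → (H →ₗ[ℂ] H)) : Prop :=
  ∀ (n : ℕ) (x : Fin n → X) (h : Fin n → H),
    0 ≤ ∑ i, ∑ j, ⟪h i, k (x i) (x j) (h j)⟫_ℂ


universe x

section KernelDilation

/-- Kolmogorov decomposition of a positive semidefinite scalar kernel. -/
theorem exists_gram_of_posSemidef {Y : Type u} (κ : Y → Y → ℂ)
    (hsymm : ∀ p q, starRingEnd ℂ (κ p q) = κ q p)
    (hpos : ∀ f : Y →₀ ℂ, 0 ≤ (f.sum fun p a ↦ f.sum fun q b ↦ starRingEnd ℂ a * κ p q * b).re) :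
    ∃ (E : Type u) (_ : NormedAddCommGroup E) (_ : InnerProductSpace ℂ E) (_ : CompleteSpace E)
      (e : Y → E), ∀ p q, ⟪e p, e q⟫_ℂ = κ p q := by
  let M : Matrix Y Y (ℂ →L[ℂ] ℂ) := .of fun p q ↦ κ p q • ContinuousLinearMap.id ℂ ℂ
  have hM : M.PosSemidef := by
    have htfae := (RKHS.posSemidef_tfae (K := M)).out 0 2
    refine htfae.mpr ⟨?_, fun f ↦ ?_⟩
    · ext p q
      simp [M, Matrix.conjTranspose_apply, ← hsymm p q, ← ContinuousLinearMap.one_def]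
    · convert! hpos f using 2
      refine Finset.sum_congr rfl fun p _ ↦ Finset.sum_congr rfl fun q _ ↦ ?_
      simp [M, hsymm]
      ring
  have : Fact M.PosSemidef := ⟨hM⟩
  refine ⟨RKHS.OfKernel M, inferInstance, inferInstance, inferInstance,
    fun p ↦ RKHS.kerFun (RKHS.OfKernel M) p 1, fun p q ↦ ?_⟩
  rw [RKHS.kerFun_inner, RKHS.kerFun_apply, RKHS.OfKernel.kernel_ofKernel]
  simp [M]

theorem IsPSDKernel.conj_symm {X : Type*} {k : X → X → (H →ₗ[ℂ] H)} (hk : IsPSDKernel k)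
    (x y : X) (h g : H) : starRingEnd ℂ ⟪h, k x y g⟫_ℂ = ⟪g, k y x h⟫_ℂ := by
  have him : ∀ (x : X) (h : H), (⟪h, k x x h⟫_ℂ).im = 0 := fun x h ↦ by
    simpa using (Complex.nonneg_iff.mp (hk 1 ![x] ![h])).2.symm
  have h₁ := (Complex.nonneg_iff.mp (hk 2 ![x, y] ![h, g])).2
  have h₂ := (Complex.nonneg_iff.mp (hk 2 ![x, y] ![h, Complex.I • g])).2
  simp only [Fin.sum_univ_two, Matrix.cons_val_zero, Matrix.cons_val_one, map_smul,
    inner_smul_left, inner_smul_right, Complex.add_im, Complex.mul_im, Complex.mul_re, him,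
    Complex.I_re, Complex.I_im, Complex.conj_I, Complex.neg_re, Complex.neg_im] at h₁ h₂
  apply Complex.ext <;> simp only [Complex.conj_re, Complex.conj_im] <;> linarith

theorem IsPSDKernel.finset_sum_nonneg {X ι : Type*} {k : X → X → (H →ₗ[ℂ] H)}
    (hk : IsPSDKernel k) (s : Finset ι) (x : ι → X) (h : ι → H) :
    0 ≤ ∑ i ∈ s, ∑ j ∈ s, ⟪h i, k (x i) (x j) (h j)⟫_ℂ := by
  have := hk s.card (fun i ↦ x (s.equivFin.symm i)) (fun i ↦ h (s.equivFin.symm i))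
  rw [s.equivFin.symm.sum_comp
    (fun i : s ↦ ∑ j, ⟪h i, k (x i) (x (s.equivFin.symm j)) (h (s.equivFin.symm j))⟫_ℂ)] at this
  simp_rw [fun i : s ↦ s.equivFin.symm.sum_comp
    (fun j : s ↦ ⟪h i, k (x i) (x j) (h j)⟫_ℂ)] at this
  rw [← s.sum_coe_sort]
  simp_rw [← s.sum_coe_sort (fun j ↦ ⟪h _, k (x _) (x j) (h j)⟫_ℂ)]
  exact this

/-- A positive semidefinite kernel factors through a Hilbert space. -/
theorem IsPSDKernel.exists_factorization {X : Type w} {k : X → X → (H →ₗ[ℂ] H)}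
    (hk : IsPSDKernel k) :
    ∃ (E : Type max u v w) (_ : NormedAddCommGroup E) (_ : InnerProductSpace ℂ E)
      (_ : CompleteSpace E) (V : X → (H →ₗ[ℂ] E)),
      ∀ (x y : X) (h g : H), ⟪V x h, V y g⟫_ℂ = ⟪h, k x y g⟫_ℂ := by
  obtain ⟨E, _, _, _, e, he⟩ := exists_gram_of_posSemidef (Y := ULift.{v} (X × H))
    (fun p q ↦ ⟪p.down.2, k p.down.1 q.down.1 q.down.2⟫_ℂ)
    (fun p q ↦ hk.conj_symm _ _ _ _) (fun f ↦ by
      convert! (Complex.nonneg_iff.mp (hk.finset_sum_nonneg f.support (fun p ↦ p.down.1)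
        (fun p ↦ f p • p.down.2))).1 using 2
      refine Finset.sum_congr rfl fun p _ ↦ Finset.sum_congr rfl fun q _ ↦ ?_
      simp only [inner_smul_left, map_smul, inner_smul_right]
      ring)
  refine ⟨E, inferInstance, inferInstance, inferInstance, fun x ↦
    { toFun := fun h ↦ e ⟨x, h⟩
      map_add' := fun h g ↦ ?_
      map_smul' := fun c h ↦ ?_ }, fun x y h g ↦ he ⟨x, h⟩ ⟨y, g⟩⟩
  · rw [← sub_eq_zero, ← inner_self_eq_zero (𝕜 := ℂ)]
    simp only [inner_sub_left, inner_sub_right, inner_add_left, inner_add_right, he, map_add]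
    ring
  · rw [← sub_eq_zero, ← inner_self_eq_zero (𝕜 := ℂ)]
    simp only [inner_sub_left, inner_sub_right, inner_smul_left, inner_smul_right, he, map_smul,
      RingHom.id_apply]
    ring

theorem LocallyHilbert.topologicalClosure_span_le (hH : LocallyHilbert Λ H) {lam : Λ} {D : Set H}
    (hD : D ⊆ hH.E lam) : (Submodule.span ℂ D).topologicalClosure ≤ hH.E lam :=
  Submodule.topologicalClosure_minimal _ (Submodule.span_le.mpr hD) (hH.isComplete lam).isClosed

/-- The adjoint condition for a locally bounded operator only has to be checked on sets
spanning dense subspaces of the strata. -/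
theorem IsLocallyBounded.of_dense {hH : LocallyHilbert Λ H} {hK : LocallyHilbert Λ K}
    {T : H →ₗ[ℂ] K} (maps_mem : ∀ lam : Λ, ∀ h ∈ hH.E lam, T h ∈ hK.E lam)
    (bound : ∀ lam : Λ, ∃ C : ℝ, ∀ h ∈ hH.E lam, ‖T h‖ ≤ C * ‖h‖)
    (D : Λ → Set K) (hD : ∀ lam, hK.E lam ≤ (Submodule.span ℂ (D lam)).topologicalClosure)
    (adj : ∀ lam : Λ, ∀ k ∈ D lam, ∃ v ∈ hH.E lam, ∀ h : H, ⟪T h, k⟫_ℂ = ⟪h, v⟫_ℂ) :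
    IsLocallyBounded hH hK T := by
  refine ⟨maps_mem, bound, fun lam k hk ↦ ?_⟩
  have : CompleteSpace (hH.E lam) := (hH.isComplete lam).completeSpace_coe
  obtain ⟨C, hC⟩ := bound lam
  have horth : ∀ h ∈ (hH.E lam)ᗮ, ⟪T h, k⟫_ℂ = 0 := by
    intro h hh
    have hle : (Submodule.span ℂ (D lam)).topologicalClosure ≤ (ℂ ∙ T h)ᗮ := by
      refine Submodule.topologicalClosure_minimal _ (Submodule.span_le.mpr fun d hd ↦ ?_)
        (Submodule.isClosed_orthogonal _)
      obtain ⟨v, hv, hTv⟩ := adj lam d hd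
      rw [SetLike.mem_coe, Submodule.mem_orthogonal_singleton_iff_inner_right, hTv]
      exact Submodule.inner_left_of_mem_orthogonal hv hh
    exact Submodule.mem_orthogonal_singleton_iff_inner_right.mp (hle (hD lam hk))
  let φ : hH.E lam →L[ℂ] ℂ :=
    LinearMap.mkContinuous ((innerSL ℂ k).toLinearMap ∘ₗ T ∘ₗ (hH.E lam).subtype) (‖k‖ * C)
      fun h ↦ by
        rw [mul_assoc]
        exact (norm_inner_le_norm _ _).trans
          (mul_le_mul_of_nonneg_left (hC h h.2) (norm_nonneg _))
  let v := (InnerProductSpace.toDual ℂ (hH.E lam)).symm φ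
  have hv : ∀ h : hH.E lam, ⟪T h, k⟫_ℂ = ⟪(h : H), v⟫_ℂ := fun h ↦ by
    rw [← inner_conj_symm, ← inner_conj_symm (h : H), ← Submodule.coe_inner,
      InnerProductSpace.toDual_symm_apply]
    rfl
  refine ⟨v, v.2, fun h ↦ ?_⟩
  obtain ⟨a, ha, b, hb, rfl⟩ := (hH.E lam).exists_add_mem_mem_orthogonal h
  rw [map_add, inner_add_left, inner_add_left, horth b hb, hv ⟨a, ha⟩,
    Submodule.inner_left_of_mem_orthogonal v.2 hb]

/-- A factorization of a kernel through a Hilbert space, with locally bounded values,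
restricts to one through a locally Hilbert space whose strata are spanned by the kernel. -/
theorem exists_minimal_linearisation [Nonempty Λ] [IsDirected Λ (· ≤ ·)]
    (hH : LocallyHilbert Λ H) {X : Type w} {k : X → X → (H →ₗ[ℂ] H)}
    (hlb : ∀ x y : X, IsLocallyBounded hH hH (k x y)) {E : Type x} [NormedAddCommGroup E]
    [InnerProductSpace ℂ E] [CompleteSpace E] (V₀ : X → (H →ₗ[ℂ] E))
    (hV₀ : ∀ (x y : X) (h g : H), ⟪V₀ x h, V₀ y g⟫_ℂ = ⟪h, k x y g⟫_ℂ) :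
    ∃ (Kb : LocHilbertBundle.{x, v} Λ) (V : X → (H →ₗ[ℂ] Kb.carrier)),
      (∀ x : X, IsLocallyBounded hH Kb.str (V x)) ∧
      (∀ (x y : X) (h g : H), ⟪V x h, V y g⟫_ℂ = ⟪h, k x y g⟫_ℂ) ∧
      (∀ lam : Λ, (Submodule.span ℂ
        {u : Kb.carrier | ∃ x : X, ∃ h ∈ hH.E lam, V x h = u}).topologicalClosure
          = Kb.str.E lam) := by
  let D : Λ → Set E := fun lam ↦ {u | ∃ x : X, ∃ h ∈ hH.E lam, V₀ x h = u}
  let F : Λ → Submodule ℂ E := fun lam ↦ (Submodule.span ℂ (D lam)).topologicalClosure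
  have hF : Monotone F := fun lam mu hle ↦ Submodule.topologicalClosure_mono
    (Submodule.span_mono fun u ⟨x, h, hh, hu⟩ ↦ ⟨x, h, hH.mono hle hh, hu⟩)
  let U : Submodule ℂ E := ⨆ lam, F lam
  have hFU : ∀ lam, F lam ≤ U := le_iSup F
  have hVF : ∀ x lam, ∀ h ∈ hH.E lam, V₀ x h ∈ F lam := fun x lam h hh ↦
    Submodule.le_topologicalClosure _ (Submodule.subset_span ⟨x, h, hh, rfl⟩)
  have hVU : ∀ x h, V₀ x h ∈ U := fun x h ↦ by
    obtain ⟨lam, hh⟩ := hH.exhaustive h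
    exact hFU lam (hVF x lam h hh)
  let str : LocallyHilbert Λ U :=
    { E := fun lam ↦ (F lam).comap U.subtype
      mono := fun lam mu hle ↦ Submodule.comap_mono (hF hle)
      isComplete := fun lam ↦ by
        have himage : U.subtypeₗᵢ '' ((F lam).comap U.subtype : Set U) = F lam := by
          have := Submodule.map_comap_subtype U (F lam)
          rw [inf_eq_right.mpr (hFU lam)] at this
          exact congrArg SetLike.coe this
        rw [← isComplete_image_iff U.subtypeₗᵢ.isometry.isUniformInducing, himage]
        exact (Submodule.isClosed_topologicalClosure _).isComplete
      exhaustive := fun u ↦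
        (Submodule.mem_iSup_of_directed F hF.directed_le).mp u.2 }
  let V : X → (H →ₗ[ℂ] U) := fun x ↦ (V₀ x).codRestrict U (hVU x)
  have hV : ∀ (x y : X) (h g : H), ⟪V x h, V y g⟫_ℂ = ⟪h, k x y g⟫_ℂ := hV₀
  have hmin : ∀ lam : Λ, (Submodule.span ℂ
      {u : U | ∃ x : X, ∃ h ∈ hH.E lam, V x h = u}).topologicalClosure = str.E lam := by
    intro lam
    refine le_antisymm (str.topologicalClosure_span_le ?_) fun u hu ↦ ?_
    · rintro _ ⟨x, h, hh, rfl⟩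
      exact hVF x lam h hh
    · rw [← SetLike.mem_coe, Submodule.topologicalClosure_coe,
        U.subtypeₗᵢ.isometry.isUniformInducing.isInducing.closure_eq_preimage_closure_image]
      have himage : U.subtypeₗᵢ '' (Submodule.span ℂ
          {u : U | ∃ x : X, ∃ h ∈ hH.E lam, V x h = u} : Set U) = Submodule.span ℂ (D lam) := by
        have hspan := Submodule.map_span U.subtype {u : U | ∃ x : X, ∃ h ∈ hH.E lam, V x h = u}
        refine (congrArg SetLike.coe hspan).trans ?_
        congr 2
        ext w
        constructor
        · rintro ⟨_, ⟨x, h, hh, rfl⟩, rfl⟩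
          exact ⟨x, h, hh, rfl⟩
        · rintro ⟨x, h, hh, rfl⟩
          exact ⟨V x h, ⟨x, h, hh, rfl⟩, rfl⟩
      rw [himage]
      exact hu
  refine ⟨⟨U, str⟩, V, fun x ↦ .of_dense (fun lam h hh ↦ hVF x lam h hh) (fun lam ↦ ?_) _
    (fun lam ↦ (hmin lam).ge) ?_, hV, hmin⟩
  · obtain ⟨C, hC⟩ := (hlb x x).bound lam
    refine ⟨√|C|, fun h hh ↦ ?_⟩
    refine (sq_le_sq₀ (norm_nonneg _) (by positivity)).mp ?_
    rw [mul_pow, Real.sq_sqrt (abs_nonneg C), ← inner_self_eq_norm_sq (𝕜 := ℂ), hV]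
    calc RCLike.re ⟪h, k x x h⟫_ℂ ≤ ‖h‖ * ‖k x x h‖ := re_inner_le_norm _ _
      _ ≤ ‖h‖ * (|C| * ‖h‖) := by
        gcongr
        exact (hC h hh).trans (by gcongr; exact le_abs_self C)
      _ = |C| * ‖h‖ ^ 2 := by ring
  · rintro lam _ ⟨y, g, hg, rfl⟩
    exact ⟨k x y g, (hlb x y).maps_mem lam g hg, fun h ↦ hV x y h g⟩

section Linearisation

variable {hH : LocallyHilbert Λ H} {hK : LocallyHilbert Λ K} {X : Type*}
  {k : X → X → (H →ₗ[ℂ] H)} {V : X → (H →ₗ[ℂ] K)}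

theorem sum_inner_kernel_eq_norm_sq
    (hV : ∀ (x y : X) (h g : H), ⟪V x h, V y g⟫_ℂ = ⟪h, k x y g⟫_ℂ)
    {n : ℕ} (x : Fin n → X) (h : Fin n → H) :
    ∑ i, ∑ j, ⟪h i, k (x i) (x j) (h j)⟫_ℂ = ((‖∑ i, V (x i) (h i)‖ ^ 2 : ℝ) : ℂ) := by
  rw [Complex.ofReal_pow]
  refine Eq.trans ?_ (inner_self_eq_norm_sq_to_K (𝕜 := ℂ) (∑ i, V (x i) (h i)))
  simp only [sum_inner, inner_sum, hV]
  exact Finset.sum_comm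

theorem exists_eq_sum_of_mem_span {lam : Λ} {u : K}
    (hu : u ∈ Submodule.span ℂ {u : K | ∃ x : X, ∃ h ∈ hH.E lam, V x h = u}) :
    ∃ (n : ℕ) (x : Fin n → X) (h : Fin n → H), (∀ i, h i ∈ hH.E lam) ∧
      ∑ i, V (x i) (h i) = u := by
  obtain ⟨n, a, d, rfl⟩ := Submodule.mem_span_set'.mp hu
  choose x h hh hd using fun i ↦ (d i).2
  exact ⟨n, x, fun i ↦ a i • h i, fun i ↦ (hH.E lam).smul_mem _ (hh i), by simp [hd]⟩

theorem eq_of_inner_linearisation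
    (hmin : ∀ lam : Λ, (Submodule.span ℂ
      {u : K | ∃ x : X, ∃ h ∈ hH.E lam, V x h = u}).topologicalClosure = hK.E lam)
    {u v : K} (huv : ∀ y g, ⟪V y g, u⟫_ℂ = ⟪V y g, v⟫_ℂ) : u = v := by
  obtain ⟨lam, hlam⟩ := hK.exhaustive (u - v)
  have hle : hK.E lam ≤ (ℂ ∙ (u - v))ᗮ := by
    rw [← hmin lam]
    refine Submodule.topologicalClosure_minimal _ (Submodule.span_le.mpr ?_)
      (Submodule.isClosed_orthogonal _)
    rintro _ ⟨y, g, -, rfl⟩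
    rw [SetLike.mem_coe, Submodule.mem_orthogonal_singleton_iff_inner_left, inner_sub_right, huv,
      sub_self]
  rw [← sub_eq_zero, ← inner_self_eq_zero (𝕜 := ℂ)]
  exact Submodule.mem_orthogonal_singleton_iff_inner_left.mp (hle hlam)

/-- The operator `V x h ↦ V (a x) h` extends boundedly to a stratum, in the weak form that the
image of each vector is characterised by its inner products with the vectors `V y g`. -/
theorem exists_bounded_weak_image
    (hV : ∀ (x y : X) (h g : H), ⟪V x h, V y g⟫_ℂ = ⟪h, k x y g⟫_ℂ)
    (hVmem : ∀ (x : X) (lam : Λ), ∀ h ∈ hH.E lam, V x h ∈ hK.E lam)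
    (hmin : ∀ lam : Λ, (Submodule.span ℂ
      {u : K | ∃ x : X, ∃ h ∈ hH.E lam, V x h = u}).topologicalClosure = hK.E lam)
    {a b : X → X} (hab : ∀ x y, k (b x) y = k x (a y)) {lam : Λ} {c : ℝ} (hc : 0 ≤ c)
    (hbound : ∀ (n : ℕ) (x : Fin n → X) (h : Fin n → H), (∀ i, h i ∈ hH.E lam) →
      ∑ i, ∑ j, ⟪h i, k (a (x i)) (a (x j)) (h j)⟫_ℂ
        ≤ (c : ℂ) * ∑ i, ∑ j, ⟪h i, k (x i) (x j) (h j)⟫_ℂ)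
    {u : K} (hu : u ∈ hK.E lam) :
    ∃ w ∈ hK.E lam, ‖w‖ ≤ √c * ‖u‖ ∧ ∀ y g, ⟪V y g, w⟫_ℂ = ⟪V (b y) g, u⟫_ℂ := by
  have hspan : ∀ u ∈ Submodule.span ℂ {u : K | ∃ x : X, ∃ h ∈ hH.E lam, V x h = u},
      ∃ w ∈ hK.E lam, ‖w‖ ≤ √c * ‖u‖ ∧ ∀ y g, ⟪V y g, w⟫_ℂ = ⟪V (b y) g, u⟫_ℂ := by
    intro u hu
    obtain ⟨n, x, h, hh, rfl⟩ := exists_eq_sum_of_mem_span hu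
    refine ⟨∑ i, V (a (x i)) (h i), sum_mem fun i _ ↦ hVmem _ _ _ (hh i), ?_, fun y g ↦ ?_⟩
    · have := hbound n x h hh
      rw [sum_inner_kernel_eq_norm_sq hV x, sum_inner_kernel_eq_norm_sq hV (fun i ↦ a (x i)),
        ← Complex.ofReal_mul, Complex.real_le_real] at this
      refine (sq_le_sq₀ (norm_nonneg _) (by positivity)).mp ?_
      rwa [mul_pow, Real.sq_sqrt hc]
    · simp only [inner_sum, hV, hab]
  have hu' := hu
  rw [← hmin lam, ← SetLike.mem_coe, Submodule.topologicalClosure_coe,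
    mem_closure_iff_seq_limit] at hu'
  obtain ⟨un, hun, hlim⟩ := hu'
  choose w hw hwle hwinner using fun n ↦ hspan (un n) (hun n)
  have hdist : ∀ n m, dist (w n) (w m) ≤ √c * dist (un n) (un m) := by
    intro n m
    obtain ⟨z, -, hzle, hzinner⟩ := hspan (un n - un m) (sub_mem (hun n) (hun m))
    have hz : w n - w m = z := eq_of_inner_linearisation hmin fun y g ↦ by
      rw [hzinner, inner_sub_right, inner_sub_right, hwinner, hwinner]
    rw [dist_eq_norm, dist_eq_norm, hz]
    exact hzle
  have hcauchy : CauchySeq w := by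
    rw [Metric.cauchySeq_iff']
    intro ε hε
    obtain ⟨N, hN⟩ := Metric.cauchySeq_iff'.mp hlim.cauchySeq (ε / (√c + 1)) (by positivity)
    refine ⟨N, fun n hn ↦ (hdist n N).trans_lt ?_⟩
    calc √c * dist (un n) (un N) ≤ (√c + 1) * dist (un n) (un N) := by gcongr; linarith
      _ < (√c + 1) * (ε / (√c + 1)) := by gcongr; exact hN n hn
      _ = ε := by field_simp
  obtain ⟨z, hz, hwz⟩ := cauchySeq_tendsto_of_isComplete (hK.isComplete lam) hw hcauchy
  refine ⟨z, hz, le_of_tendsto_of_tendsto' hwz.norm (hlim.norm.const_mul _) hwle, fun y g ↦ ?_⟩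
  refine tendsto_nhds_unique (tendsto_const_nhds.inner hwz) ?_
  simp_rw [hwinner]
  exact tendsto_const_nhds.inner hlim

theorem continuousOn_stratum_of_bound {T : H →ₗ[ℂ] K}
    (bound : ∀ lam : Λ, ∃ C : ℝ, ∀ h ∈ hH.E lam, ‖T h‖ ≤ C * ‖h‖) (lam : Λ) :
    ContinuousOn T (hH.E lam) := by
  obtain ⟨C, hC⟩ := bound lam
  refine (LipschitzOnWith.of_dist_le_mul (K := C.toNNReal) fun u hu v hv ↦ ?_).continuousOn
  rw [dist_eq_norm, dist_eq_norm, ← map_sub]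
  exact (hC _ (sub_mem hu hv)).trans
    (mul_le_mul_of_nonneg_right (Real.le_coe_toNNReal C) (norm_nonneg _))

/-- A minimal linearisation of an invariant kernel carries the dilated `*`-representation. -/
theorem exists_representation {S : Type*} [Semigroup S] [StarMul S]
    (hV : ∀ (x y : X) (h g : H), ⟪V x h, V y g⟫_ℂ = ⟪h, k x y g⟫_ℂ)
    (hVmem : ∀ (x : X) (lam : Λ), ∀ h ∈ hH.E lam, V x h ∈ hK.E lam)
    (hmin : ∀ lam : Λ, (Submodule.span ℂ
      {u : K | ∃ x : X, ∃ h ∈ hH.E lam, V x h = u}).topologicalClosure = hK.E lam)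
    {act : S → X → X} (hact : ∀ (s t : S) (x : X), act (s * t) x = act s (act t x))
    (hinv : ∀ (s : S) (x y : X), k (act s x) y = k x (act (star s) y))
    (hbound : ∀ (s : S) (lam : Λ), ∃ c : ℝ, 0 ≤ c ∧
      ∀ (n : ℕ) (x : Fin n → X) (h : Fin n → H), (∀ i, h i ∈ hH.E lam) →
        ∑ i, ∑ j, ⟪h i, k (act s (x i)) (act s (x j)) (h j)⟫_ℂ
          ≤ (c : ℂ) * ∑ i, ∑ j, ⟪h i, k (x i) (x j) (h j)⟫_ℂ) :
    ∃ π : S → (K →ₗ[ℂ] K),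
      (∀ s : S, IsLocallyBounded hK hK (π s)) ∧
      (∀ s t : S, π (s * t) = (π s) ∘ₗ (π t)) ∧
      (∀ s : S, IsLAdjoint (π s) (π (star s))) ∧
      (∀ (s : S) (x : X), V (act s x) = (π s) ∘ₗ (V x)) := by
  have hinv' : ∀ (s : S) (x y : X), k (act (star s) x) y = k x (act s y) := fun s x y ↦ by
    rw [hinv, star_star]
  choose c hc hcbound using hbound
  have himage : ∀ (s : S) (lam : Λ), ∀ u ∈ hK.E lam, ∃ w ∈ hK.E lam, ‖w‖ ≤ √(c s lam) * ‖u‖ ∧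
      ∀ y g, ⟪V y g, w⟫_ℂ = ⟪V (act (star s) y) g, u⟫_ℂ := fun s lam u hu ↦
    exists_bounded_weak_image hV hVmem hmin (hinv' s) (hc s lam) (hcbound s lam) hu
  have hex : ∀ (s : S) (u : K), ∃ w : K, ∀ y g, ⟪V y g, w⟫_ℂ = ⟪V (act (star s) y) g, u⟫_ℂ :=
    fun s u ↦ by
      obtain ⟨lam, hu⟩ := hK.exhaustive u
      obtain ⟨w, -, -, hw⟩ := himage s lam u hu
      exact ⟨w, hw⟩
  choose p hp using hex
  let π : S → (K →ₗ[ℂ] K) := fun s ↦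
    { toFun := p s
      map_add' := fun u v ↦ eq_of_inner_linearisation hmin fun y g ↦ by
        simp only [inner_add_right, hp]
      map_smul' := fun r u ↦ eq_of_inner_linearisation hmin fun y g ↦ by
        simp only [inner_smul_right, hp, RingHom.id_apply] }
  have hπ : ∀ (s : S) (u : K) y g, ⟪V y g, π s u⟫_ℂ = ⟪V (act (star s) y) g, u⟫_ℂ := hp
  have hπV : ∀ (s : S) (x : X) (h : H), V (act s x) h = π s (V x h) := fun s x h ↦
    eq_of_inner_linearisation hmin fun y g ↦ by rw [hπ, hV, hV, hinv']
  have hstrat : ∀ (s : S) (lam : Λ), ∀ u ∈ hK.E lam,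
      π s u ∈ hK.E lam ∧ ‖π s u‖ ≤ √(c s lam) * ‖u‖ := fun s lam u hu ↦ by
    obtain ⟨w, hw, hwle, hwinner⟩ := himage s lam u hu
    have : π s u = w := eq_of_inner_linearisation hmin fun y g ↦ by rw [hπ, hwinner]
    rw [this]
    exact ⟨hw, hwle⟩
  have hπbound : ∀ (s : S) (lam : Λ), ∃ C : ℝ, ∀ u ∈ hK.E lam, ‖π s u‖ ≤ C * ‖u‖ :=
    fun s lam ↦ ⟨_, fun u hu ↦ (hstrat s lam u hu).2⟩
  have hadj : ∀ s : S, IsLAdjoint (π s) (π (star s)) := by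
    intro s u z
    obtain ⟨lam, hu⟩ := hK.exhaustive u
    let M := Submodule.span ℂ {u : K | ∃ x : X, ∃ h ∈ hH.E lam, V x h = u}
    have hM : (hK.E lam : Set K) = closure M := by
      rw [← hmin lam, Submodule.topologicalClosure_coe]
    have hEq : Set.EqOn (fun u ↦ ⟪π s u, z⟫_ℂ) (fun u ↦ ⟪u, π (star s) z⟫_ℂ) M := by
      intro u hu
      obtain ⟨n, x, h, -, rfl⟩ := exists_eq_sum_of_mem_span hu
      simp only [map_sum, sum_inner, ← hπV, hπ, star_star]
    exact hEq.of_subset_closure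
      ((continuousOn_stratum_of_bound (hπbound s) lam).inner continuousOn_const)
      (continuousOn_id.inner continuousOn_const) (hM ▸ subset_closure) hM.le hu
  refine ⟨π, fun s ↦ ⟨fun lam u hu ↦ (hstrat s lam u hu).1, hπbound s, fun lam z hz ↦
    ⟨π (star s) z, (hstrat (star s) lam z hz).1, fun u ↦ hadj s u z⟩⟩, fun s t ↦ ?_, hadj,
    fun s x ↦ LinearMap.ext (hπV s x)⟩
  ext u
  refine eq_of_inner_linearisation hmin fun y g ↦ ?_
  rw [LinearMap.comp_apply, hπ, hπ, hπ, star_mul, hact]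

/-- A kernel with an invariant linearisation is positive semidefinite, invariant, and satisfies
the boundedness condition. -/
theorem invariant_kernel_of_linearisation {S : Type*} [Star S]
    (hV : ∀ (x y : X) (h g : H), ⟪V x h, V y g⟫_ℂ = ⟪h, k x y g⟫_ℂ)
    (hVmem : ∀ (x : X) (lam : Λ), ∀ h ∈ hH.E lam, V x h ∈ hK.E lam)
    {act : S → X → X} {π : S → (K →ₗ[ℂ] K)}
    (hπ : ∀ (s : S) (lam : Λ), ∃ C : ℝ, ∀ u ∈ hK.E lam, ‖π s u‖ ≤ C * ‖u‖)
    (hadj : ∀ s : S, IsLAdjoint (π s) (π (star s)))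
    (hπV : ∀ (s : S) (x : X), V (act s x) = (π s) ∘ₗ (V x)) :
    IsPSDKernel k ∧
      (∀ (s : S) (x y : X), k (act s x) y = k x (act (star s) y)) ∧
      (∀ (s : S) (lam : Λ), ∃ c : ℝ, 0 ≤ c ∧
        ∀ (n : ℕ) (x : Fin n → X) (h : Fin n → H), (∀ i, h i ∈ hH.E lam) →
          ∑ i, ∑ j, ⟪h i, k (act s (x i)) (act s (x j)) (h j)⟫_ℂ
            ≤ (c : ℂ) * ∑ i, ∑ j, ⟪h i, k (x i) (x j) (h j)⟫_ℂ) := by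
  refine ⟨fun n x h ↦ ?_, fun s x y ↦ ?_, fun s lam ↦ ?_⟩
  · rw [sum_inner_kernel_eq_norm_sq hV, Complex.zero_le_real]
    positivity
  · ext g
    refine ext_inner_left ℂ fun h ↦ ?_
    rw [← hV, ← hV, hπV, hπV]
    exact hadj s _ _
  · obtain ⟨C, hC⟩ := hπ s lam
    refine ⟨C ^ 2, sq_nonneg C, fun n x h hh ↦ ?_⟩
    rw [sum_inner_kernel_eq_norm_sq hV x, sum_inner_kernel_eq_norm_sq hV (fun i ↦ act s (x i)),
      ← Complex.ofReal_mul, Complex.real_le_real, ← mul_pow]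
    refine pow_le_pow_left₀ (norm_nonneg _) ?_ 2
    have := hC (∑ i, V (x i) (h i)) (sum_mem fun i _ ↦ hVmem _ _ _ (hh i))
    simpa [map_sum, hπV] using this

end Linearisation

end KernelDilation

/-- Dilation theorem for positive semidefinite kernels, with values
locally bounded operators on a locally Hilbert space, invariant under the left action
of a `*`-semigroup `S` on `X`: the kernel `k` is positive semidefinite, invariant, and
satisfies the Sz.-Nagy type boundedness condition (b) if and only if it admits an
invariant locally Hilbert space linearisation `(K; π; V)`; moreover, in that case the
triple can be chosen minimal. -/
theorem invariant_kernel_dilation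
    {Λ : Type v} [PartialOrder Λ] [Nonempty Λ] [IsDirected Λ (· ≤ ·)]
    {H : Type u} [NormedAddCommGroup H] [InnerProductSpace ℂ H]
    (hH : LocallyHilbert Λ H)
    {S : Type x} [Semigroup S] [StarMul S]
    {X : Type w} [Nonempty X]
    (act : S → X → X) (hact : ∀ (s t : S) (x : X), act (s * t) x = act s (act t x))
    (k : X → X → (H →ₗ[ℂ] H)) (hlb : ∀ x y : X, IsLocallyBounded hH hH (k x y)) :
    (((IsPSDKernel (H := H) k) ∧
      (∀ (s : S) (x y : X), k (act s x) y = k x (act (star s) y)) ∧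
      (∀ (s : S) (lam : Λ), ∃ c : ℝ, 0 ≤ c ∧
        ∀ (n : ℕ) (x : Fin n → X) (h : Fin n → H), (∀ i, h i ∈ hH.E lam) →
          ∑ i, ∑ j, ⟪h i, k (act s (x i)) (act s (x j)) (h j)⟫_ℂ
            ≤ (c : ℂ) * ∑ i, ∑ j, ⟪h i, k (x i) (x j) (h j)⟫_ℂ)) ↔
      (∃ (Kb : LocHilbertBundle.{max u v w x, v} Λ)
         (π : S → (Kb.carrier →ₗ[ℂ] Kb.carrier)) (V : X → (H →ₗ[ℂ] Kb.carrier)),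
        (∀ s : S, IsLocallyBounded Kb.str Kb.str (π s)) ∧
        (∀ s t : S, π (s * t) = (π s) ∘ₗ (π t)) ∧
        (∀ s : S, IsLAdjoint (π s) (π (star s))) ∧
        (∀ x : X, IsLocallyBounded hH Kb.str (V x)) ∧
        (∀ (x y : X) (h g : H), ⟪V x h, V y g⟫_ℂ = ⟪h, k x y g⟫_ℂ) ∧
        (∀ (s : S) (x : X), V (act s x) = (π s) ∘ₗ (V x)))) ∧
    (((IsPSDKernel (H := H) k) ∧
      (∀ (s : S) (x y : X), k (act s x) y = k x (act (star s) y)) ∧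
      (∀ (s : S) (lam : Λ), ∃ c : ℝ, 0 ≤ c ∧
        ∀ (n : ℕ) (x : Fin n → X) (h : Fin n → H), (∀ i, h i ∈ hH.E lam) →
          ∑ i, ∑ j, ⟪h i, k (act s (x i)) (act s (x j)) (h j)⟫_ℂ
            ≤ (c : ℂ) * ∑ i, ∑ j, ⟪h i, k (x i) (x j) (h j)⟫_ℂ)) →
      (∃ (Kb : LocHilbertBundle.{max u v w x, v} Λ)
         (π : S → (Kb.carrier →ₗ[ℂ] Kb.carrier)) (V : X → (H →ₗ[ℂ] Kb.carrier)),
        (∀ s : S, IsLocallyBounded Kb.str Kb.str (π s)) ∧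
        (∀ s t : S, π (s * t) = (π s) ∘ₗ (π t)) ∧
        (∀ s : S, IsLAdjoint (π s) (π (star s))) ∧
        (∀ x : X, IsLocallyBounded hH Kb.str (V x)) ∧
        (∀ (x y : X) (h g : H), ⟪V x h, V y g⟫_ℂ = ⟪h, k x y g⟫_ℂ) ∧
        (∀ (s : S) (x : X), V (act s x) = (π s) ∘ₗ (V x)) ∧
        (∀ lam : Λ,
          (Submodule.span ℂ
            {u : Kb.carrier | ∃ x : X, ∃ h ∈ hH.E lam, V x h = u}).topologicalClosure
              = Kb.str.E lam))) := by
  refine (and_iff_right_of_imp fun hmin ↦ ?_).mpr ?_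
  · refine ⟨fun hk ↦ ?_, ?_⟩
    · obtain ⟨Kb, π, V, hπ, hmul, hadj, hVlb, hV, hπV, -⟩ := hmin hk
      exact ⟨Kb, π, V, hπ, hmul, hadj, hVlb, hV, hπV⟩
    · rintro ⟨Kb, π, V, hπ, -, hadj, hVlb, hV, hπV⟩
      exact invariant_kernel_of_linearisation hV (fun x ↦ (hVlb x).maps_mem)
        (fun s ↦ (hπ s).bound) hadj hπV
  · rintro ⟨hk, hinv, hbound⟩
    obtain ⟨E, _, _, _, V₀, hV₀⟩ := IsPSDKernel.exists_factorization.{u, max v x, w} hk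
    obtain ⟨Kb, V, hVlb, hV, hmin⟩ := exists_minimal_linearisation hH hlb V₀ hV₀
    obtain ⟨π, hπ, hmul, hadj, hπV⟩ :=
      exists_representation hV (fun x ↦ (hVlb x).maps_mem) hmin hact hinv hbound
    exact ⟨Kb, π, V, hπ, hmul, hadj, hVlb, hV, hπV, hmin⟩
end
end

section
/- Let A be a locally C*-algebra with defining monotone family of C*-seminorms (p_i)_{i∈I}, and let E be a Hilbert locally C*-module over A. Then there exist locally Hilbert spaces H = ⋃_{i∈I} H_i and K = ⋃_{i∈I} K_i over the directed poset I, an injective linear map φ : A → B_loc(H) with φ(ab) = φ(a) ∘ φ(b) and φ(a*) = φ(a)* for all a, b ∈ A, satisfying ‖φ(a)|_{H_i}‖ = p_i(a) for all a ∈ A and i ∈ I (in particular φ is coherent and faithful), and an injective linear map Φ : E → B_loc(H,K), coherent in the sense that p_i([e,e]) = 0 implies Φ(e)h = 0 for all h ∈ H_i, such that Φ(e)* ∘ Φ(f) = φ([e,f]) and Φ(e·a) = Φ(e) ∘ φ(a) for all e, f ∈ E and a ∈ A. -/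
open scoped InnerProductSpace ComplexOrder

noncomputable section

universe u v w

variable {Λ : Type v} [PartialOrder Λ]
variable {H : Type u} [NormedAddCommGroup H] [InnerProductSpace ℂ H]
variable {K : Type w} [NormedAddCommGroup K] [InnerProductSpace ℂ K]

universe x

/-- A locally C*-algebra structure on the complex associative `*`-algebra `A`: a
monotone family of C*-seminorms indexed by a directed poset `I`, which separates the
points of `A` (Hausdorff) and for which `A` is complete; completeness is expressed via
Cauchy filters for the family of seminorms. -/
structure LocallyCStar (I : Type x) [Preorder I] (A : Type w)
    [Ring A] [StarRing A] [Algebra ℂ A] [StarModule ℂ A] : Type (max w x) where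
  p : I → A → ℝ
  nonneg : ∀ (i : I) (a : A), 0 ≤ p i a
  add_le : ∀ (i : I) (a b : A), p i (a + b) ≤ p i a + p i b
  smul_eq : ∀ (i : I) (c : ℂ) (a : A), p i (c • a) = ‖c‖ * p i a
  mul_le : ∀ (i : I) (a b : A), p i (a * b) ≤ p i a * p i b
  star_eq : ∀ (i : I) (a : A), p i (star a) = p i a
  cstar : ∀ (i : I) (a : A), p i (star a * a) = p i a ^ 2
  mono : ∀ ⦃i j : I⦄, i ≤ j → ∀ a : A, p i a ≤ p j a
  separating : ∀ a : A, (∀ i : I, p i a = 0) → a = 0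
  complete : ∀ F : Filter A, F.NeBot →
    (∀ (i : I) (ε : ℝ), 0 < ε → ∃ s ∈ F, ∀ a ∈ s, ∀ b ∈ s, p i (a - b) < ε) →
    ∃ x : A, ∀ (i : I) (ε : ℝ), 0 < ε → {a : A | p i (a - x) < ε} ∈ F

universe y

/-- A Hilbert locally C*-module structure over the locally C*-algebra `(A, pA)` on the
complex vector space `E`: a right `A`-module structure, an `A`-valued gramian, and
completeness for the seminorms `e ↦ p_i([e,e])^{1/2}` (expressed via Cauchy filters;
the Hausdorff property follows from definiteness of the gramian and separation in `A`). -/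
structure HilbertLocCStarModule (I : Type x) [Preorder I]
    (A : Type w) [Ring A] [StarRing A] [Algebra ℂ A] [StarModule ℂ A]
    (pA : LocallyCStar I A)
    (E : Type y) [AddCommGroup E] [Module ℂ E] : Type (max w x y) where
  smulA : E →ₗ[ℂ] A →ₗ[ℂ] E
  smulA_mul : ∀ (e : E) (a b : A), smulA (smulA e a) b = smulA e (a * b)
  g : E → E → A
  g_add_right : ∀ e f f' : E, g e (f + f') = g e f + g e f'
  g_smul_right : ∀ (e : E) (c : ℂ) (f : E), g e (c • f) = c • g e f
  g_star : ∀ e f : E, star (g e f) = g f e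
  g_mod : ∀ (e f : E) (a : A), g e (smulA f a) = g e f * a
  g_pos : ∀ e : E, ∃ b : A, g e e = star b * b
  g_definite : ∀ e : E, g e e = 0 → e = 0
  complete : ∀ F : Filter E, F.NeBot →
    (∀ (i : I) (ε : ℝ), 0 < ε → ∃ s ∈ F, ∀ e ∈ s, ∀ f ∈ s,
      Real.sqrt (pA.p i (g (e - f) (e - f))) < ε) →
    ∃ x : E, ∀ (i : I) (ε : ℝ), 0 < ε →
      {e : E | Real.sqrt (pA.p i (g (e - x) (e - x))) < ε} ∈ F

section StateExistence

variable {B : Type*} [CStarAlgebra B]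

/-- A unital contractive functional on a C*-algebra is real on self-adjoint elements. -/
lemma im_apply_eq_zero_of_isSelfAdjoint [Nontrivial B] (f : StrongDual ℂ B) (hf : ‖f‖ ≤ 1)
    (h1 : f 1 = 1) {a : B} (ha : IsSelfAdjoint a) : (f a).im = 0 := by
  have key : ∀ t : ℝ, ((f a).im + t) ^ 2 ≤ ‖a‖ ^ 2 + t ^ 2 := by
    intro t
    set b : B := a + ((t : ℂ) * Complex.I) • 1 with hb
    have hfb : f b = f a + (t : ℂ) * Complex.I := by simp [hb, h1]
    have h2 : star b * b = a * a + ((t : ℂ) ^ 2) • (1 : B) := by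
      simp only [hb, star_add, star_smul, star_one, ha.star_eq, mul_add, add_mul, smul_mul_assoc,
        mul_smul_comm, one_mul, mul_one, smul_add, smul_smul]
      have e1 : star ((t : ℂ) * Complex.I) = -((t : ℂ) * Complex.I) := by simp
      have e2 : ((t : ℂ) * Complex.I) * ((t : ℂ) * Complex.I) = -(t : ℂ) ^ 2 := by
        linear_combination (t : ℂ) ^ 2 * Complex.I_sq
      rw [e1, mul_neg, e2, neg_neg, neg_smul]
      abel
    have h3 : ‖b‖ ^ 2 ≤ ‖a‖ ^ 2 + t ^ 2 := by
      rw [sq, ← CStarRing.norm_star_mul_self, h2]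
      refine (norm_add_le _ _).trans (add_le_add ?_ ?_)
      · rw [sq]; exact norm_mul_le _ _
      · rw [norm_smul]; simp
    have h4 : ‖f b‖ ≤ ‖b‖ := by
      simpa using (f.le_opNorm b).trans (mul_le_mul_of_nonneg_right hf (norm_nonneg b))
    have h5 : |(f b).im| ≤ ‖b‖ := (Complex.abs_im_le_norm _).trans h4
    have h6 : (f b).im = (f a).im + t := by simp [hfb]
    rw [← h6, ← sq_abs]
    exact (pow_le_pow_left₀ (abs_nonneg _) h5 2).trans h3
  by_contra hne
  have h := key (‖a‖ ^ 2 / (2 * (f a).im))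
  have h' : 2 * (f a).im * (‖a‖ ^ 2 / (2 * (f a).im)) = ‖a‖ ^ 2 := by field_simp
  have : 0 < (f a).im ^ 2 := by positivity
  nlinarith

variable [PartialOrder B] [StarOrderedRing B]

/-- A unital contractive functional on a C*-algebra is positive. -/
lemma nonneg_apply_of_norm_le_one [Nontrivial B] (f : StrongDual ℂ B) (hf : ‖f‖ ≤ 1)
    (h1 : f 1 = 1) {a : B} (ha : 0 ≤ a) : 0 ≤ f a := by
  have hsa : IsSelfAdjoint a := .of_nonneg ha
  have him := im_apply_eq_zero_of_isSelfAdjoint f hf h1 hsa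
  have hle : a ≤ algebraMap ℝ B ‖a‖ := hsa.le_algebraMap_norm_self
  have h2 : ‖algebraMap ℝ B ‖a‖ - a‖ ≤ ‖a‖ :=
    (CStarAlgebra.norm_le_iff_le_algebraMap _ (norm_nonneg a) (sub_nonneg.2 hle)).2
      (sub_le_self _ ha)
  have h3 : f (algebraMap ℝ B ‖a‖ - a) = (‖a‖ : ℂ) - f a := by
    rw [map_sub, Algebra.algebraMap_eq_smul_one, ← Complex.coe_smul, map_smul, h1]; simp
  have h4 : ‖(‖a‖ : ℂ) - f a‖ ≤ ‖a‖ := by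
    rw [← h3]
    refine (f.le_opNorm _).trans ((mul_le_mul_of_nonneg_right hf (norm_nonneg _)).trans ?_)
    simpa using h2
  have h5 := (Complex.re_le_norm _).trans h4
  rw [Complex.nonneg_iff]
  simp only [Complex.sub_re, Complex.ofReal_re] at h5
  exact ⟨by linarith, him.symm⟩

/-- Every positive element of a C*-algebra has a state attaining its norm. -/
lemma exists_state_apply_eq_norm [Nontrivial B] {a : B} (ha : 0 ≤ a) :
    ∃ f : B →ₚ[ℂ] ℂ, f 1 = 1 ∧ f a = ‖a‖ := by
  have hsa : IsSelfAdjoint a := .of_nonneg ha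
  have : IsStarNormal a := hsa.isStarNormal
  let S := StarAlgebra.elemental ℂ a
  let a' : S := ⟨a, StarAlgebra.elemental.self_mem ℂ a⟩
  have hspec : (‖a‖ : ℂ) ∈ spectrum ℂ a' := by
    have h1 : ((algebraMap ℝ ℂ) ‖a‖) ∈ spectrum ℂ a :=
      spectrum.algebraMap_mem ℂ (CStarAlgebra.norm_mem_spectrum_of_nonneg ha)
    have : IsClosed (S : Set B) := StarAlgebra.elemental.isClosed ℂ a
    rwa [StarSubalgebra.spectrum_eq (S := S) (a := a')]
  obtain ⟨χ, hχ⟩ := WeakDual.CharacterSpace.mem_spectrum_iff_exists.1 hspec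
  let g : StrongDual ℂ S.toSubalgebra.toSubmodule := WeakDual.toStrongDual (χ : WeakDual ℂ S)
  have hg : ‖g‖ ≤ 1 := by
    refine g.opNorm_le_bound zero_le_one fun x => ?_
    rw [one_mul]
    exact spectrum.norm_le_norm_of_mem (A := S) (WeakDual.CharacterSpace.apply_mem_spectrum χ x)
  obtain ⟨f, hfg, hfn⟩ := exists_extension_norm_eq _ g
  have h1 : f 1 = 1 := (hfg (1 : S)).trans (map_one χ)
  refine ⟨PositiveLinearMap.mk₀ f.toLinearMap
    fun x hx => nonneg_apply_of_norm_le_one f (hfn.trans_le hg) h1 hx, h1, ?_⟩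
  exact (hfg a').trans hχ

end StateExistence

section LocalAlgebra

variable {I : Type x} [Preorder I] {A : Type w} [Ring A] [StarRing A] [Algebra ℂ A]
  [StarModule ℂ A]

namespace LocallyCStar

set_option linter.unusedVariables false in
/-- The algebra `A`, regarded as a seminormed algebra with the seminorm `p i`. -/
@[nolint unusedArguments]
def AtIndex (pA : LocallyCStar I A) (i : I) : Type w := A

variable (pA : LocallyCStar I A) (i : I)

instance : Ring (pA.AtIndex i) := inferInstanceAs (Ring A)
instance : StarRing (pA.AtIndex i) := inferInstanceAs (StarRing A)
instance : Algebra ℂ (pA.AtIndex i) := inferInstanceAs (Algebra ℂ A)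
instance : StarModule ℂ (pA.AtIndex i) := inferInstanceAs (StarModule ℂ A)

lemma map_zero : pA.p i 0 = 0 := by simpa using pA.smul_eq i 0 0

lemma map_neg (a : A) : pA.p i (-a) = pA.p i a := by simpa using pA.smul_eq i (-1) a

/-- The seminorm `p i` as an additive group seminorm. -/
def addGroupSeminorm : AddGroupSeminorm (pA.AtIndex i) where
  toFun := pA.p i
  map_zero' := pA.map_zero i
  add_le' := pA.add_le i
  neg' := pA.map_neg i

instance : SeminormedRing (pA.AtIndex i) where
  __ := (pA.addGroupSeminorm i).toSeminormedAddCommGroup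
  __ : Ring (pA.AtIndex i) := inferInstance
  norm_mul_le := pA.mul_le i

instance : NormedSpace ℂ (pA.AtIndex i) where
  norm_smul_le c a := (pA.smul_eq i c a).le

instance : NormedStarGroup (pA.AtIndex i) where
  norm_star_le a := (pA.star_eq i a).le

lemma norm_atIndex (a : pA.AtIndex i) : ‖a‖ = pA.p i a := rfl

/-- The C*-algebra obtained by completing `A` with respect to `p i`. -/
abbrev Compl : Type w := UniformSpace.Completion (pA.AtIndex i)

open UniformSpace

instance : Star (pA.Compl i) := ⟨Completion.map star⟩

lemma continuous_compl_star : Continuous (star : pA.Compl i → pA.Compl i) :=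
  Completion.continuous_map

lemma coe_star (a : pA.AtIndex i) :
    ((star a : pA.AtIndex i) : pA.Compl i) = star (a : pA.Compl i) :=
  (Completion.map_coe (star_isometry (E := pA.AtIndex i)).uniformContinuous a).symm

instance : StarRing (pA.Compl i) where
  star_involutive a := by
    have hs := pA.continuous_compl_star i
    induction a using Completion.induction_on with
    | hp => exact isClosed_eq (hs.comp hs) continuous_id
    | ih a => rw [← coe_star, ← coe_star, star_star]
  star_mul a b := by
    have hs := pA.continuous_compl_star i
    induction a, b using Completion.induction_on₂ with
    | hp =>
      exact isClosed_eq (hs.comp continuous_mul)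
        ((hs.comp continuous_snd).mul (hs.comp continuous_fst))
    | ih a b =>
      rw [← Completion.coe_mul, ← coe_star, ← coe_star, ← coe_star, star_mul,
        Completion.coe_mul]
  star_add a b := by
    have hs := pA.continuous_compl_star i
    induction a, b using Completion.induction_on₂ with
    | hp =>
      exact isClosed_eq (hs.comp continuous_add)
        ((hs.comp continuous_fst).add (hs.comp continuous_snd))
    | ih a b =>
      rw [← Completion.coe_add, ← coe_star, ← coe_star, ← coe_star, star_add,
        Completion.coe_add]

instance : CStarRing (pA.Compl i) where
  norm_mul_self_le a := by
    have hs := pA.continuous_compl_star i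
    induction a using Completion.induction_on with
    | hp => exact isClosed_le (by fun_prop) ((hs.mul continuous_id).norm)
    | ih a =>
      rw [← coe_star, ← Completion.coe_mul, Completion.norm_coe, Completion.norm_coe,
        norm_atIndex, norm_atIndex, ← sq]
      exact (pA.cstar i a).ge

instance : StarModule ℂ (pA.Compl i) where
  star_smul c a := by
    have hs := pA.continuous_compl_star i
    have hc : ∀ c : ℂ, Continuous fun a : pA.Compl i => c • a :=
      fun c => uniformContinuous_const_smul c |>.continuous
    induction a using Completion.induction_on with
    | hp => exact isClosed_eq (hs.comp (hc c)) ((hc (star c)).comp hs)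
    | ih a => rw [← Completion.coe_smul, ← coe_star, ← coe_star, star_smul, Completion.coe_smul]

instance : NormedAlgebra ℂ (pA.Compl i) where
  norm_smul_le := norm_smul_le

instance : CStarAlgebra (pA.Compl i) where

/-- The canonical map of `A` into its completion with respect to `p i`. -/
def toCompl : A →ₗ[ℂ] pA.Compl i :=
  (Completion.toComplₗᵢ (𝕜 := ℂ) (E := pA.AtIndex i)).toLinearMap

lemma toCompl_mul (a b : A) : pA.toCompl i (a * b) = pA.toCompl i a * pA.toCompl i b :=
  Completion.coe_mul (α := pA.AtIndex i) a b

lemma toCompl_one : pA.toCompl i 1 = 1 := rfl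

lemma toCompl_star (a : A) : pA.toCompl i (star a) = star (pA.toCompl i a) :=
  pA.coe_star i a

lemma norm_toCompl (a : A) : ‖pA.toCompl i a‖ = pA.p i a :=
  Completion.norm_coe (E := pA.AtIndex i) a

/-- A positive linear functional on `A` that is dominated by the seminorm `p i`. -/
structure PosFunctional where
  toFun : A →ₗ[ℂ] ℂ
  map_star' : ∀ a, toFun (star a) = star (toFun a)
  nonneg' : ∀ a, 0 ≤ toFun (star a * a)
  conj_le' : ∀ a b, (toFun (star b * (star a * a) * b)).re ≤
    pA.p i (star a * a) * (toFun (star b * b)).re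

/-- Every seminorm `p i` is attained by a contractive positive functional dominated by it. -/
lemma exists_posFunctional (a : A) : ∃ f : pA.PosFunctional i,
    (f.toFun 1).re ≤ 1 ∧ (f.toFun (star a * a)).re = pA.p i a ^ 2 := by
  cases subsingleton_or_nontrivial (pA.Compl i) with
  | inl h =>
    refine ⟨⟨0, by simp, by simp, by simp⟩, by simp, ?_⟩
    rw [← norm_toCompl, Subsingleton.elim (pA.toCompl i a) 0]
    simp
  | inr h =>
    let _ : PartialOrder (pA.Compl i) := CStarAlgebra.spectralOrder _
    have _ : StarOrderedRing (pA.Compl i) := CStarAlgebra.spectralOrderedRing _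
    obtain ⟨f, h1, hf⟩ := exists_state_apply_eq_norm (star_mul_self_nonneg (pA.toCompl i a))
    refine ⟨⟨f.toLinearMap ∘ₗ pA.toCompl i, fun b => ?_, fun b => ?_, fun b c => ?_⟩, ?_, ?_⟩
    · change f (pA.toCompl i (star b)) = star (f (pA.toCompl i b))
      rw [toCompl_star, map_star]
    · change 0 ≤ f (pA.toCompl i (star b * b))
      rw [toCompl_mul, toCompl_star]
      exact map_nonneg f (star_mul_self_nonneg _)
    · change (f (pA.toCompl i _)).re ≤ _ * (f (pA.toCompl i _)).re
      rw [← norm_toCompl]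
      simp only [toCompl_mul, toCompl_star]
      have := OrderHomClass.mono f (CStarAlgebra.star_left_conjugate_le_norm_smul
        (a := pA.toCompl i c) (b := star (pA.toCompl i b) * pA.toCompl i b)
        (IsSelfAdjoint.star_mul_self _))
      rw [← Complex.coe_smul, map_smul] at this
      simpa using (Complex.le_def.1 this).1
    · change (f (pA.toCompl i 1)).re ≤ 1
      rw [toCompl_one, h1]; simp
    · change (f (pA.toCompl i (star a * a))).re = _
      rw [toCompl_mul, toCompl_star, hf, CStarRing.norm_star_mul_self, norm_toCompl, ← sq]
      exact Complex.ofReal_re _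

end LocallyCStar

end LocalAlgebra

section HilbertSum

variable {I : Type*} [PartialOrder I] {ι : Type*} (r : ι → I)
  (G : ι → Type*) [∀ α, NormedAddCommGroup (G α)] [∀ α, InnerProductSpace ℂ (G α)]

/-- The vectors of the Hilbert sum of the `G α` supported on `{α | r α ≤ i}`. -/
def supportedLp (i : I) : Submodule ℂ (lp G 2) where
  carrier := {h | ∀ α, ¬ r α ≤ i → h α = 0}
  zero_mem' _ _ := rfl
  add_mem' {h k} hh hk α hα := by simp [hh α hα, hk α hα]
  smul_mem' c h hh α hα := by simp [hh α hα]

lemma mem_supportedLp {i : I} {h : lp G 2} :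
    h ∈ supportedLp r G i ↔ ∀ α, ¬ r α ≤ i → h α = 0 := Iff.rfl

lemma supportedLp_mono : Monotone (supportedLp r G) :=
  fun _ _ hij _ hh α hα => hh α fun h => hα (h.trans hij)

lemma isClosed_supportedLp (i : I) : IsClosed (supportedLp r G i : Set (lp G 2)) := by
  have : (supportedLp r G i : Set (lp G 2)) = ⋂ α, ⋂ (_ : ¬ r α ≤ i), {h | h α = 0} := by
    ext h; simp [mem_supportedLp]
  rw [this]
  refine isClosed_iInter fun α => isClosed_iInter fun _ => isClosed_eq ?_ continuous_const
  exact (continuous_apply α).comp lp.uniformContinuous_coe.continuous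

/-- The inner product space of vectors supported on some `{α | r α ≤ i}`. -/
abbrev HilbertSum := ↥(⨆ i, supportedLp r G i)

namespace HilbertSum

variable {r G}
variable {G' : ι → Type*} [∀ α, NormedAddCommGroup (G' α)] [∀ α, InnerProductSpace ℂ (G' α)]

/-- A family of bounded operators that is uniformly bounded on each `{α | r α ≤ i}`. -/
def LocallyUniformlyBounded (r : ι → I) (T : ∀ α, G α →L[ℂ] G' α) : Prop :=
  ∀ i, ∃ C : ℝ, 0 ≤ C ∧ ∀ α, r α ≤ i → ‖T α‖ ≤ C

lemma norm_apply_le {T : ∀ α, G α →L[ℂ] G' α} {i : I} {C : ℝ}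
    (hT : ∀ α, r α ≤ i → ‖T α‖ ≤ C) {h : lp G 2} (hh : h ∈ supportedLp r G i) (α : ι) :
    ‖T α (h α)‖ ≤ C * ‖h α‖ := by
  by_cases hα : r α ≤ i
  · exact ((T α).le_opNorm _).trans (mul_le_mul_of_nonneg_right (hT α hα) (norm_nonneg _))
  · simp [hh α hα]

lemma memℓp_apply {T : ∀ α, G α →L[ℂ] G' α} {i : I} {C : ℝ}
    (hT : ∀ α, r α ≤ i → ‖T α‖ ≤ C) {h : lp G 2} (hh : h ∈ supportedLp r G i) :
    Memℓp (fun α => T α (h α)) 2 :=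
  ((lp.memℓp h).norm.const_mul C).mono fun α => norm_apply_le hT hh α

lemma inner_def (h k : HilbertSum r G) : ⟪h, k⟫_ℂ = ∑' α, ⟪h.1 α, k.1 α⟫_ℂ :=
  lp.inner_eq_tsum _ _

lemma LocallyUniformlyBounded.adjoint [∀ α, CompleteSpace (G α)]
    [∀ α, CompleteSpace (G' α)] {T : ∀ α, G α →L[ℂ] G' α}
    (hT : LocallyUniformlyBounded r T) :
    LocallyUniformlyBounded r fun α => ContinuousLinearMap.adjoint (T α) := fun i => by
  obtain ⟨C, hC₀, hC⟩ := hT i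
  exact ⟨C, hC₀, fun α hα => by simpa using hC α hα⟩

end HilbertSum

variable [IsDirected I (· ≤ ·)] [Nonempty I]

lemma mem_iSup_supportedLp {h : lp G 2} :
    h ∈ ⨆ i, supportedLp r G i ↔ ∃ i, h ∈ supportedLp r G i :=
  Submodule.mem_iSup_of_directed _ (supportedLp_mono r G).directed_le

/-- The locally Hilbert space structure on `HilbertSum r G`. -/
def HilbertSum.locallyHilbert [∀ α, CompleteSpace (G α)] : LocallyHilbert I (HilbertSum r G) where
  E i := (supportedLp r G i).comap (Submodule.subtype _)
  mono _ _ hij := Submodule.comap_mono (supportedLp_mono r G hij)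
  isComplete i := by
    rw [← isUniformEmbedding_subtype_val.isUniformInducing.isComplete_iff]
    convert! (isClosed_supportedLp r G i).isComplete
    ext h
    refine ⟨?_, fun hh => ⟨⟨h, (mem_iSup_supportedLp r G).2 ⟨i, hh⟩⟩, hh, rfl⟩⟩
    rintro ⟨k, hk, rfl⟩
    exact hk
  exhaustive h := (mem_iSup_supportedLp r G).1 h.2

namespace HilbertSum

variable {r G}
variable {G' : ι → Type*} [∀ α, NormedAddCommGroup (G' α)] [∀ α, InnerProductSpace ℂ (G' α)]

/-- The diagonal operator on Hilbert sums induced by a family of bounded operators. -/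
def diag (T : ∀ α, G α →L[ℂ] G' α) (hT : LocallyUniformlyBounded r T) :
    HilbertSum r G →ₗ[ℂ] HilbertSum r G' where
  toFun h := ⟨⟨fun α => T α (h.1 α), by
    obtain ⟨i, hi⟩ := (mem_iSup_supportedLp r G).1 h.2
    obtain ⟨C, -, hC⟩ := hT i
    exact memℓp_apply hC hi⟩, by
    obtain ⟨i, hi⟩ := (mem_iSup_supportedLp r G).1 h.2
    exact (mem_iSup_supportedLp r G').2 ⟨i, fun α hα => by simp [hi α hα]⟩⟩
  map_add' h k := by
    ext α; exact map_add (T α) (h.1 α) (k.1 α)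
  map_smul' c h := by
    ext α; exact map_smul (T α) c (h.1 α)

@[simp]
lemma diag_apply (T : ∀ α, G α →L[ℂ] G' α) (hT : LocallyUniformlyBounded r T)
    (h : HilbertSum r G) (α : ι) : (diag T hT h).1 α = T α (h.1 α) := rfl

lemma norm_diag_le (T : ∀ α, G α →L[ℂ] G' α) (hT : LocallyUniformlyBounded r T) {i : I} {C : ℝ}
    (hC₀ : 0 ≤ C) (hC : ∀ α, r α ≤ i → ‖T α‖ ≤ C) {h : HilbertSum r G}
    (hh : h.1 ∈ supportedLp r G i) : ‖diag T hT h‖ ≤ C * ‖h‖ := by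
  have h1 : ‖(diag T hT h).1‖ ≤ ‖(C : ℂ) • h.1‖ := by
    refine lp.norm_mono two_ne_zero fun α => ?_
    rw [diag_apply, lp.coeFn_smul, Pi.smul_apply, norm_smul, Complex.norm_real,
      Real.norm_of_nonneg hC₀]
    exact norm_apply_le hC hh α
  rwa [norm_smul, Complex.norm_real, Real.norm_of_nonneg hC₀] at h1

variable [∀ α, CompleteSpace (G α)] [∀ α, CompleteSpace (G' α)]

lemma isLocallyBounded_diag (T : ∀ α, G α →L[ℂ] G' α) (hT : LocallyUniformlyBounded r T) :
    IsLocallyBounded (locallyHilbert r G) (locallyHilbert r G') (diag T hT) where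
  maps_mem i h hh α hα := (congrArg (T α) (hh α hα)).trans (map_zero (T α))
  bound i := by
    obtain ⟨C, hC₀, hC⟩ := hT i
    exact ⟨C, fun h hh => norm_diag_le T hT hC₀ hC hh⟩
  adjoint_mem i k hk := by
    refine ⟨diag _ hT.adjoint k, fun α hα => ?_, fun h => ?_⟩
    · exact (congrArg (ContinuousLinearMap.adjoint (T α)) (hk α hα)).trans (map_zero _)
    · simp only [inner_def, diag_apply, ContinuousLinearMap.adjoint_inner_right]

end HilbertSum

end HilbertSum

section ModuleRepresentation

open UniformSpace

variable {I : Type x} {A : Type w} [Ring A] [StarRing A] [Algebra ℂ A] [StarModule ℂ A]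
  {E : Type y} [AddCommGroup E] [Module ℂ E]

/-- A locally C*-algebra as a Hilbert module over itself. -/
def LocallyCStar.selfModule [Preorder I] (pA : LocallyCStar I A) :
    HilbertLocCStarModule I A pA A where
  smulA := LinearMap.mul ℂ A
  smulA_mul e a b := mul_assoc e a b
  g a b := star a * b
  g_add_right a b c := mul_add _ b c
  g_smul_right a c b := mul_smul_comm c _ b
  g_star a b := by rw [star_mul, star_star]
  g_mod a b c := (mul_assoc _ b c).symm
  g_pos a := ⟨a, rfl⟩
  g_definite a ha := pA.separating a fun i => by
    have := pA.cstar i a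
    rwa [ha, pA.map_zero, eq_comm, sq_eq_zero_iff] at this
  complete F hF h := by
    simp only [pA.cstar, Real.sqrt_sq (pA.nonneg _ _)] at h ⊢
    exact pA.complete F hF h

namespace HilbertLocCStarModule

section GNS

variable [Preorder I] {pA : LocallyCStar I A} (M : HilbertLocCStarModule I A pA E)

lemma g_add_left (e e' f : E) : M.g (e + e') f = M.g e f + M.g e' f := by
  rw [← M.g_star, M.g_add_right, star_add, M.g_star, M.g_star]

lemma g_smul_left (c : ℂ) (e f : E) : M.g (c • e) f = star c • M.g e f := by
  rw [← M.g_star, M.g_smul_right, star_smul, M.g_star]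

lemma g_mod_left (e f : E) (a : A) : M.g (M.smulA e a) f = star a * M.g e f := by
  rw [← M.g_star, M.g_mod, star_mul, M.g_star]

variable {i : I} (f : pA.PosFunctional i)

set_option linter.unusedVariables false in
/-- The module `E` with the semi-inner product induced by a positive functional on `A`. -/
@[nolint unusedArguments]
def PreGNS (M : HilbertLocCStarModule I A pA E) (f : pA.PosFunctional i) : Type y := E

instance : AddCommGroup (M.PreGNS f) := inferInstanceAs (AddCommGroup E)
instance : Module ℂ (M.PreGNS f) := inferInstanceAs (Module ℂ E)

/-- The semi-inner product `(e, e') ↦ f [e, e']`. -/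
abbrev preGNSCore : PreInnerProductSpace.Core ℂ (M.PreGNS f) where
  inner e e' := f.toFun (M.g e e')
  conj_inner_symm e e' := (f.map_star' _).symm.trans (congrArg f.toFun (M.g_star e' e))
  re_inner_nonneg e := by
    obtain ⟨b, hb⟩ := M.g_pos e
    rw [hb]
    exact (Complex.nonneg_iff.1 (f.nonneg' b)).1
  add_left e e' e'' := (congrArg f.toFun (M.g_add_left e e' e'')).trans (map_add _ _ _)
  smul_left e e' c := (congrArg f.toFun (M.g_smul_left c e e')).trans (map_smul _ _ _)

instance : SeminormedAddCommGroup (M.PreGNS f) :=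
  InnerProductSpace.Core.toSeminormedAddCommGroup (c := M.preGNSCore f)

instance : InnerProductSpace ℂ (M.PreGNS f) := InnerProductSpace.ofCore (M.preGNSCore f)

/-- The Hilbert space associated with `M` and a positive functional on `A`. -/
abbrev GNS : Type y := Completion (M.PreGNS f)

/-- The canonical map of `E` to its Hilbert space completion. -/
def gnsMk : E →ₗ[ℂ] M.GNS f :=
  (Completion.toComplₗᵢ (𝕜 := ℂ) (E := M.PreGNS f)).toLinearMap

@[elab_as_elim]
lemma gns_induction {p : M.GNS f → Prop} (u : M.GNS f) (closed : IsClosed {u | p u})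
    (mk : ∀ e, p (M.gnsMk f e)) : p u :=
  Completion.induction_on u closed mk

lemma inner_gnsMk (e e' : E) : ⟪M.gnsMk f e, M.gnsMk f e'⟫_ℂ = f.toFun (M.g e e') :=
  Completion.inner_coe (E := M.PreGNS f) e e'

lemma norm_gnsMk_sq (e : E) : ‖M.gnsMk f e‖ ^ 2 = (f.toFun (M.g e e)).re := by
  rw [← inner_gnsMk, ← inner_self_eq_norm_sq (𝕜 := ℂ)]; rfl

lemma norm_gnsMk_smulA_le (e : E) (a : A) :
    ‖M.gnsMk f (M.smulA e a)‖ ≤ √(pA.p i (M.g e e)) * ‖pA.selfModule.gnsMk f a‖ := by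
  rw [← sq_le_sq₀ (norm_nonneg _) (by positivity), mul_pow, Real.sq_sqrt (pA.nonneg _ _),
    norm_gnsMk_sq, norm_gnsMk_sq]
  obtain ⟨b, hb⟩ := M.g_pos e
  rw [M.g_mod, M.g_mod_left, hb]
  exact f.conj_le' b a

/-- The operator `a ↦ e · a` between Hilbert spaces. -/
def act (e : E) : pA.selfModule.GNS f →L[ℂ] M.GNS f :=
  ContinuousLinearMap.fromCompletion
    (LinearMap.mkContinuous (E := pA.selfModule.PreGNS f) (M.gnsMk f ∘ₗ M.smulA e)
      (√(pA.p i (M.g e e))) fun a =>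
        (M.norm_gnsMk_smulA_le f e a).trans_eq
          (congrArg _ (Completion.norm_coe (E := pA.selfModule.PreGNS f) a)))

lemma act_gnsMk (e : E) (a : A) :
    M.act f e (pA.selfModule.gnsMk f a) = M.gnsMk f (M.smulA e a) :=
  ContinuousLinearMap.fromCompletion_apply_coe _ _

lemma norm_act_le (e : E) : ‖M.act f e‖ ≤ √(pA.p i (M.g e e)) := by
  refine ContinuousLinearMap.opNorm_le_bound _ (Real.sqrt_nonneg _) fun u => ?_
  induction u using gns_induction with
  | closed => exact isClosed_le (by fun_prop) (by fun_prop)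
  | mk a =>
    rw [act_gnsMk]
    exact M.norm_gnsMk_smulA_le f e a

lemma act_add (e e' : E) (u : pA.selfModule.GNS f) :
    M.act f (e + e') u = M.act f e u + M.act f e' u := by
  induction u using gns_induction with
  | closed => exact isClosed_eq (by fun_prop) (by fun_prop)
  | mk a => simp [act_gnsMk]

lemma act_smul (c : ℂ) (e : E) (u : pA.selfModule.GNS f) :
    M.act f (c • e) u = c • M.act f e u := by
  induction u using gns_induction with
  | closed => exact isClosed_eq (by fun_prop) ((M.act f e).continuous.const_smul c)
  | mk a => simp [act_gnsMk]

lemma act_smulA (e : E) (a : A) (u : pA.selfModule.GNS f) :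
    M.act f (M.smulA e a) u = M.act f e (pA.selfModule.act f a u) := by
  induction u using gns_induction with
  | closed => exact isClosed_eq (by fun_prop) (by fun_prop)
  | mk b =>
    rw [act_gnsMk, act_gnsMk, act_gnsMk, M.smulA_mul]
    rfl

lemma inner_act_act (e e' : E) (u v : pA.selfModule.GNS f) :
    ⟪M.act f e u, M.act f e' v⟫_ℂ = ⟪u, pA.selfModule.act f (M.g e e') v⟫_ℂ := by
  induction u using gns_induction with
  | closed => exact isClosed_eq (by fun_prop) (by fun_prop)
  | mk a =>
    induction v using gns_induction with
    | closed => exact isClosed_eq (by fun_prop) (by fun_prop)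
    | mk b =>
      rw [act_gnsMk, act_gnsMk, act_gnsMk, inner_gnsMk, inner_gnsMk, M.g_mod, M.g_mod_left]
      exact congrArg f.toFun (mul_assoc (star a) (M.g e e') b)

lemma act_one (u : pA.selfModule.GNS f) : pA.selfModule.act f 1 u = u := by
  induction u using gns_induction with
  | closed => exact isClosed_eq (by fun_prop) continuous_id
  | mk a =>
    rw [act_gnsMk]
    exact congrArg (pA.selfModule.gnsMk f) (one_mul a)

end GNS

section Sum

variable [PartialOrder I]

/-- The index set of the Hilbert sums: one state for each seminorm and each element of `A`. -/
abbrev SumIndex (I : Type x) (A : Type w) : Type (max u w x) := ULift.{u} (I × A)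

/-- The index of the seminorm belonging to a summand. -/
abbrev SumIndex.level (α : SumIndex.{u, w, x} I A) : I := α.down.1

variable {pA : LocallyCStar I A} (M : HilbertLocCStarModule I A pA E)

variable (pA) in
/-- A functional attaining the seminorm `p i a`, where `α = (i, a)`. -/
def normingFunctional (α : SumIndex.{u, w, x} I A) : pA.PosFunctional α.level :=
  (pA.exists_posFunctional α.level α.down.2).choose

variable (pA) in
lemma normingFunctional_spec (α : SumIndex.{u, w, x} I A) :
    ((normingFunctional pA α).toFun 1).re ≤ 1 ∧
      ((normingFunctional pA α).toFun (star α.down.2 * α.down.2)).re =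
        pA.p α.level α.down.2 ^ 2 :=
  (pA.exists_posFunctional α.level α.down.2).choose_spec

/-- The summands of the Hilbert sum. -/
abbrev Summand (α : SumIndex.{u, w, x} I A) := M.GNS (normingFunctional pA α)

lemma norm_act_le_of_le (e : E) {i : I} (α : SumIndex.{u, w, x} I A) (hα : α.level ≤ i) :
    ‖M.act (normingFunctional pA α) e‖ ≤ √(pA.p i (M.g e e)) :=
  (M.norm_act_le _ e).trans (Real.sqrt_le_sqrt (pA.mono hα _))

lemma locallyUniformlyBounded_act (e : E) : HilbertSum.LocallyUniformlyBounded
    (SumIndex.level (I := I) (A := A))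
    fun α : SumIndex.{u, w, x} I A => M.act (normingFunctional pA α) e :=
  fun _ => ⟨_, Real.sqrt_nonneg _, M.norm_act_le_of_le e⟩

/-- The Hilbert sum of the completions of `E`. -/
abbrev SumSpace : Type (max u w x y) :=
  HilbertSum (SumIndex.level (I := I) (A := A)) M.Summand.{u, w, x, y}

variable [IsDirected I (· ≤ ·)] [Nonempty I]

/-- The representation of a Hilbert module by operators between locally Hilbert spaces. -/
def rep : E →ₗ[ℂ]
    SumSpace.{u, w, x, w} pA.selfModule →ₗ[ℂ] SumSpace.{u, w, x, y} M where
  toFun e := HilbertSum.diag _ (M.locallyUniformlyBounded_act e)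
  map_add' e e' := by
    ext h α; exact M.act_add _ e e' (h.1 α)
  map_smul' c e := by
    ext h α; exact M.act_smul _ c e (h.1 α)

lemma rep_apply (e : E) (h : SumSpace.{u, w, x, w} pA.selfModule)
    (α : SumIndex.{u, w, x} I A) :
    (M.rep e h).1 α = M.act (normingFunctional pA α) e (h.1 α) := rfl

lemma norm_rep_le (e : E) {i : I} {h : SumSpace.{u, w, x, w} pA.selfModule}
    (hh : h.1 ∈ supportedLp SumIndex.level _ i) : ‖M.rep e h‖ ≤ √(pA.p i (M.g e e)) * ‖h‖ :=
  HilbertSum.norm_diag_le _ (M.locallyUniformlyBounded_act e) (Real.sqrt_nonneg _)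
    (M.norm_act_le_of_le e) hh

lemma inner_rep_rep (e e' : E)
    (h h' : SumSpace.{u, w, x, w} pA.selfModule) :
    ⟪M.rep e h, M.rep e' h'⟫_ℂ = ⟪h, pA.selfModule.rep (M.g e e') h'⟫_ℂ := by
  simp only [HilbertSum.inner_def, rep_apply, inner_act_act]

lemma rep_smulA (e : E) (a : A) :
    M.rep (M.smulA e a) = M.rep e ∘ₗ (rep.{u, w, x, w} pA.selfModule a) := by
  ext h α; exact M.act_smulA _ e a (h.1 α)

lemma rep_one : rep.{u, w, x, w} pA.selfModule (1 : A) = LinearMap.id := by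
  ext h α; exact act_one _ (h.1 α)

lemma isLAdjoint_rep (a : A) :
    IsLAdjoint (rep.{u, w, x, w} pA.selfModule a) (pA.selfModule.rep (star a)) := by
  intro h k
  have := pA.selfModule.inner_rep_rep a 1 h k
  rwa [rep_one, LinearMap.id_apply, show pA.selfModule.g a 1 = star a from mul_one _] at this

/-- Each seminorm is the norm of the restriction of the representation of the algebra. -/
lemma restNorm_rep (a : A) (i : I) :
    restNorm ((HilbertSum.locallyHilbert SumIndex.level
      (Summand.{u, w, x, w} pA.selfModule)).E i) (pA.selfModule.rep a) = pA.p i a := by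
  classical
  have hg : √(pA.p i (pA.selfModule.g a a)) = pA.p i a := by
    change √(pA.p i (star a * a)) = _
    rw [pA.cstar, Real.sqrt_sq (pA.nonneg _ _)]
  refine IsLeast.csInf_eq ⟨⟨pA.nonneg i a, fun h hh => ?_⟩, fun C ⟨hC₀, hC⟩ => ?_⟩
  · rw [← hg]
    exact norm_rep_le _ a hh
  · let α : SumIndex.{u, w, x} I A := ⟨i, a⟩
    obtain ⟨h1, h2⟩ := normingFunctional_spec pA α
    let f := normingFunctional pA α
    let ξ : pA.selfModule.GNS f := pA.selfModule.gnsMk f 1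
    let v : lp (Summand.{u, w, x, w} pA.selfModule) 2 := lp.single 2 α ξ
    have hv : v ∈ supportedLp SumIndex.level _ i := by
      intro β hβ
      refine lp.single_apply_ne (E := Summand.{u, w, x, w} pA.selfModule) 2 α ξ ?_
      rintro rfl
      exact hβ le_rfl
    have hξ : ‖ξ‖ ≤ 1 := by
      rw [← sq_le_one_iff₀ (norm_nonneg _), norm_gnsMk_sq]
      change (f.toFun (star 1 * 1)).re ≤ 1
      rwa [star_one, one_mul]
    have hact : ‖pA.selfModule.act f a ξ‖ = pA.p i a := by
      rw [act_gnsMk, ← sq_eq_sq₀ (norm_nonneg _) (pA.nonneg _ _), norm_gnsMk_sq]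
      change (f.toFun (star (a * 1) * (a * 1))).re = _
      rwa [mul_one]
    let h : SumSpace.{u, w, x, w} pA.selfModule :=
      ⟨v, (mem_iSup_supportedLp _ _).2 ⟨i, hv⟩⟩
    have h3 : ‖h‖ = ‖ξ‖ :=
      lp.norm_single (E := Summand.{u, w, x, w} pA.selfModule) (by norm_num) α ξ
    have h4 : (pA.selfModule.rep a h).1 α = pA.selfModule.act f a ξ :=
      congrArg (pA.selfModule.act f a)
        (lp.single_apply_self (E := Summand.{u, w, x, w} pA.selfModule) 2 α ξ)
    calc pA.p i a = ‖(pA.selfModule.rep a h).1 α‖ := by rw [h4, hact]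
      _ ≤ ‖pA.selfModule.rep a h‖ := lp.norm_apply_le_norm two_ne_zero _ α
      _ ≤ C * ‖h‖ := hC h hv
      _ ≤ C := by rw [h3]; exact mul_le_of_le_one_right hC₀ hξ

lemma rep_self_injective : Function.Injective (rep.{u, w, x, w} pA.selfModule) := by
  refine (injective_iff_map_eq_zero _).2 fun a ha => pA.separating a fun i => ?_
  rw [← restNorm_rep.{u, w, x} a i, ha]
  exact IsLeast.csInf_eq ⟨⟨le_rfl, by simp⟩, fun C hC => hC.1⟩

lemma rep_injective : Function.Injective (rep.{u, w, x, y} M) := by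
  refine (injective_iff_map_eq_zero _).2 fun e he => M.g_definite e ?_
  refine (injective_iff_map_eq_zero _).1 (rep_self_injective.{u, w, x} (pA := pA)) _ ?_
  ext1 h
  refine ext_inner_left ℂ fun k => ?_
  rw [← inner_rep_rep, he]
  simp

end Sum

end HilbertLocCStarModule

end ModuleRepresentation

/-- Every Hilbert locally C*-module `E` over a locally C*-algebra `A`
is isomorphic to a concrete Hilbert locally C*-module: there are locally Hilbert spaces
`H` and `K` over the index poset of `A`, a faithful coherent `*`-representation
`φ : A → B_loc(H)` with `‖φ(a)|_{H_i}‖ = p_i(a)`, and an injective coherent linear map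
`Φ : E → B_loc(H,K)` with `Φ(e)* ∘ Φ(f) = φ([e,f])` and `Φ(e·a) = Φ(e) ∘ φ(a)`. -/
theorem hilbertLocCStarModule_representation
    {I : Type x} [PartialOrder I] [Nonempty I] [IsDirected I (· ≤ ·)]
    {A : Type w} [Ring A] [StarRing A] [Algebra ℂ A] [StarModule ℂ A]
    (pA : LocallyCStar I A)
    {E : Type y} [AddCommGroup E] [Module ℂ E]
    (M : HilbertLocCStarModule I A pA E) :
    ∃ (Hb : LocHilbertBundle.{max w x y, x} I) (Kb : LocHilbertBundle.{max w x y, x} I)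
      (φ : A →ₗ[ℂ] (Hb.carrier →ₗ[ℂ] Hb.carrier))
      (Φ : E →ₗ[ℂ] (Hb.carrier →ₗ[ℂ] Kb.carrier)),
      (∀ a : A, IsLocallyBounded Hb.str Hb.str (φ a)) ∧
      (∀ a b : A, φ (a * b) = (φ a) ∘ₗ (φ b)) ∧
      (∀ a : A, IsLAdjoint (φ a) (φ (star a))) ∧
      Function.Injective φ ∧
      (∀ (a : A) (i : I), restNorm (Hb.str.E i) (φ a) = pA.p i a) ∧
      (∀ e : E, IsLocallyBounded Hb.str Kb.str (Φ e)) ∧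
      Function.Injective Φ ∧
      (∀ (i : I) (e : E), pA.p i (M.g e e) = 0 → ∀ h ∈ Hb.str.E i, Φ e h = 0) ∧
      (∀ (e f : E) (h h' : Hb.carrier), ⟪Φ e h, Φ f h'⟫_ℂ = ⟪h, φ (M.g e f) h'⟫_ℂ) ∧
      (∀ (e : E) (a : A), Φ (M.smulA e a) = (Φ e) ∘ₗ (φ a)) := by
  refine ⟨⟨_, HilbertSum.locallyHilbert HilbertLocCStarModule.SumIndex.level
      (HilbertLocCStarModule.Summand.{y, w, x, w} pA.selfModule)⟩,
    ⟨_, HilbertSum.locallyHilbert HilbertLocCStarModule.SumIndex.level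
      (HilbertLocCStarModule.Summand.{y, w, x, y} M)⟩,
    pA.selfModule.rep, M.rep, fun a => HilbertSum.isLocallyBounded_diag _
      (pA.selfModule.locallyUniformlyBounded_act a),
    pA.selfModule.rep_smulA, HilbertLocCStarModule.isLAdjoint_rep,
    HilbertLocCStarModule.rep_self_injective, HilbertLocCStarModule.restNorm_rep,
    fun e => HilbertSum.isLocallyBounded_diag _ (M.locallyUniformlyBounded_act e),
    M.rep_injective, fun i e he h hh => ?_,
    M.inner_rep_rep, M.rep_smulA⟩
  have := M.norm_rep_le e hh
  rw [he, Real.sqrt_zero, zero_mul] at this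
  exact norm_le_zero_iff.1 this
end
end

section
/- Let A be a unital locally C*-algebra with defining monotone family of C*-seminorms (p_i)_{i∈I}, let H = ⋃_{λ∈Λ} H_λ be a locally Hilbert space (the directed poset Λ being unrelated to I), and let φ : A → B_loc(H) be a linear map that is continuous in the sense that for every λ ∈ Λ there exist i ∈ I and C ≥ 0 with ‖φ(a)h‖ ≤ C · p_i(a) · ‖h‖ for all a ∈ A and h ∈ H_λ. The following are equivalent: (1) φ is positive semidefinite (equivalently, completely positive); (2) there exist a locally Hilbert space K = ⋃_{λ∈Λ} K_λ over Λ, a *-representation π : A → B_loc(K) (linear, with π(ab) = π(a) ∘ π(b) and π(a*) = π(a)*) that is continuous in the same sense (for every λ ∈ Λ there exist i ∈ I and C ≥ 0 with ‖π(a)k‖ ≤ C · p_i(a) · ‖k‖ for all a ∈ A, k ∈ K_λ), and W ∈ B_loc(H,K) such that φ(a) = W* ∘ π(a) ∘ W for all a ∈ A. -/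
open scoped InnerProductSpace ComplexOrder

noncomputable section

universe u v w

variable {Λ : Type v} [PartialOrder Λ]
variable {H : Type u} [NormedAddCommGroup H] [InnerProductSpace ℂ H]
variable {K : Type w} [NormedAddCommGroup K] [InnerProductSpace ℂ K]

universe x

universe y

/-- Kolmogorov decomposition of a scalar positive semidefinite kernel: the feature vectors
`e x` are total in a Hilbert space. -/
theorem exists_kolmogorov_decomposition {X : Type x} (k : X → X → ℂ)
    (hk : ∀ (s : Finset X) (c : X → ℂ),
      0 ≤ ∑ x ∈ s, ∑ y ∈ s, star (c x) * c y * k x y) :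
    ∃ (E : Type x) (_ : NormedAddCommGroup E) (_ : InnerProductSpace ℂ E)
      (_ : CompleteSpace E) (e : X → E),
      (∀ x y, ⟪e x, e y⟫_ℂ = k x y) ∧ (∀ f : E, (∀ x, ⟪e x, f⟫_ℂ = 0) → f = 0) := by
  classical
  have herm (x y : X) : star (k x y) = k y x := by
    have hdiag (z : X) : 0 ≤ k z z := by simpa using hk {z} 1
    rcases eq_or_ne x y with rfl | hxy
    · exact (IsSelfAdjoint.of_nonneg (hdiag x)).star_eq
    · have h1 := (Complex.nonneg_iff.1 (hk {x, y} 1)).2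
      have h2 := (Complex.nonneg_iff.1 (hk {x, y} (fun z => if z = x then 1 else Complex.I))).2
      have hx := (Complex.nonneg_iff.1 (hdiag x)).2
      have hy := (Complex.nonneg_iff.1 (hdiag y)).2
      simp [Finset.sum_pair hxy, hxy.symm] at h1 h2
      apply Complex.ext <;> simp <;> linarith
  let core : PreInnerProductSpace.Core ℂ (X →₀ ℂ) :=
    { inner := fun f g => f.sum fun x z => g.sum fun y w => star z * w * k x y
      conj_inner_symm := fun f g => by
        rw [Finsupp.sum_comm]
        simp only [Finsupp.sum, map_sum]
        refine Finset.sum_congr rfl fun x _ => Finset.sum_congr rfl fun y _ => ?_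
        rw [← herm y x]
        simp [mul_comm]
      add_left := fun f g h => by
        rw [Finsupp.sum_add_index'] <;> simp [← Finsupp.sum_add, add_mul]
      smul_left := fun f g c => by
        rw [Finsupp.sum_smul_index] <;> simp [Finsupp.mul_sum, ← mul_assoc]
      re_inner_nonneg := fun f => (Complex.nonneg_iff.1 (hk f.support f)).1 }
  let _ : SeminormedAddCommGroup (X →₀ ℂ) :=
    InnerProductSpace.Core.toSeminormedAddCommGroup (𝕜 := ℂ)
  let _ : InnerProductSpace ℂ (X →₀ ℂ) := .ofCore _
  have inner_def (f g : X →₀ ℂ) :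
      ⟪f, g⟫_ℂ = f.sum fun x z => g.sum fun y w => star z * w * k x y := rfl
  refine ⟨UniformSpace.Completion (X →₀ ℂ), inferInstance, inferInstance, inferInstance,
    fun x => ((Finsupp.single x 1 : X →₀ ℂ) : UniformSpace.Completion (X →₀ ℂ)), ?_, ?_⟩
  · intro x y
    rw [UniformSpace.Completion.inner_coe, inner_def]
    simp
  · intro f hf
    refine UniformSpace.Completion.denseRange_coe.eq_zero_of_inner_right ℂ fun g => ?_
    induction g using Finsupp.induction_linear with
    | zero => rw [UniformSpace.Completion.coe_zero, inner_zero_left]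
    | add g₁ g₂ h₁ h₂ => rw [UniformSpace.Completion.coe_add, inner_add_left, h₁, h₂, add_zero]
    | single x c =>
      have : (Finsupp.single x c : X →₀ ℂ) = c • Finsupp.single x 1 := by simp
      rw [this, UniformSpace.Completion.coe_smul, inner_smul_left, hf, mul_zero]

/-- A bounded linear relation cut out by adjointness conditions extends from a subspace to its
closure. -/
theorem exists_adjoint_of_mem_topologicalClosure {E F : Type*}
    [NormedAddCommGroup E] [InnerProductSpace ℂ E] [NormedAddCommGroup F] [InnerProductSpace ℂ F]
    (T : Set (F × E)) (D : Submodule ℂ E) (S : Submodule ℂ F) (hS : IsComplete (S : Set F)) (C : ℝ)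
    (hD : ∀ k ∈ D, ∃ v ∈ S, ∀ t ∈ T, ⟪t.2, k⟫_ℂ = ⟪t.1, v⟫_ℂ)
    (hb : ∀ k ∈ D, ∀ v ∈ S, (∀ t ∈ T, ⟪t.2, k⟫_ℂ = ⟪t.1, v⟫_ℂ) → ‖v‖ ≤ C * ‖k‖)
    {k : E} (hk : k ∈ D.topologicalClosure) :
    ∃ v ∈ S, (∀ t ∈ T, ⟪t.2, k⟫_ℂ = ⟪t.1, v⟫_ℂ) ∧ ‖v‖ ≤ C * ‖k‖ := by
  obtain ⟨x, hxD, hx⟩ := mem_closure_iff_seq_limit.1 hk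
  choose v hvS hv using fun n => hD (x n) (hxD n)
  have hdist (m n : ℕ) : dist (v m) (v n) ≤ C * dist (x m) (x n) := by
    rw [dist_eq_norm, dist_eq_norm]
    refine hb _ (D.sub_mem (hxD m) (hxD n)) _ (S.sub_mem (hvS m) (hvS n)) fun t ht => ?_
    rw [inner_sub_right, inner_sub_right, hv m t ht, hv n t ht]
  have hcauchy : CauchySeq v := by
    have hd := (cauchySeq_iff_tendsto_dist_atTop_0.1 hx.cauchySeq).const_mul C
    rw [mul_zero] at hd
    exact cauchySeq_iff_tendsto_dist_atTop_0.2
      (squeeze_zero (fun _ => dist_nonneg) (fun n => hdist n.1 n.2) hd)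
  obtain ⟨w, hwS, hw⟩ := cauchySeq_tendsto_of_isComplete hS hvS hcauchy
  refine ⟨w, hwS, fun t ht => ?_, ?_⟩
  · refine tendsto_nhds_unique (tendsto_const_nhds.inner hx) ?_
    simp_rw [hv _ t ht]
    exact tendsto_const_nhds.inner hw
  · exact le_of_tendsto_of_tendsto' hw.norm (hx.norm.const_mul C)
      fun n => hb _ (hxD n) _ (hvS n) (hv n)

/-- The spectral radius trick: a bound `f ≤ M p` by a C*-seminorm together with the
Cauchy–Schwarz inequality `f c ^ 2 ≤ f (c* c) N` improves to `f ≤ N p`. -/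
theorem le_mul_of_sq_le_star_mul_self {A : Type*} [Mul A] [Star A] {p f : A → ℝ} {M N : ℝ}
    (hp : ∀ c, 0 ≤ p c) (hpstar : ∀ c, p (star c * c) = p c ^ 2) (hN : 0 ≤ N)
    (hfM : ∀ c, f c ≤ M * p c) (hcs : ∀ c, f c ^ 2 ≤ f (star c * c) * N) (c : A) :
    f c ≤ N * p c := by
  have key (n : ℕ) : ∀ c, f c ^ 2 ^ n * N ≤ M * (N * p c) ^ 2 ^ n := by
    induction n with
    | zero =>
      intro c
      have := mul_le_mul_of_nonneg_right (hfM c) hN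
      simp only [pow_zero, pow_one]
      linarith
    | succ n ih =>
      intro c
      calc f c ^ 2 ^ (n + 1) * N = (f c ^ 2) ^ 2 ^ n * N := by rw [← pow_mul, pow_succ' 2 n]
        _ ≤ (f (star c * c) * N) ^ 2 ^ n * N := by gcongr; exact hcs c
        _ = f (star c * c) ^ 2 ^ n * N * N ^ 2 ^ n := by ring
        _ ≤ M * (N * p (star c * c)) ^ 2 ^ n * N ^ 2 ^ n := mul_le_mul_of_nonneg_right (ih _) (by positivity)
        _ = M * (N * p c) ^ 2 ^ (n + 1) := by
          rw [hpstar, pow_succ' 2 n, pow_mul, mul_assoc, ← mul_pow]; ring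
  rcases hN.eq_or_lt with rfl | hN
  · have h := hcs c
    rw [mul_zero] at h
    rw [zero_mul]
    exact (pow_eq_zero_iff two_ne_zero).1 (le_antisymm h (sq_nonneg _)) |>.le
  by_contra! hlt
  rcases (mul_nonneg hN.le (hp c)).eq_or_lt with h0 | hpos
  · have hpc : p c = 0 := by simpa [hN.ne'] using h0.symm
    have := hfM c
    rw [hpc, mul_zero] at this hlt
    linarith
  obtain ⟨n, hn⟩ := pow_unbounded_of_one_lt (M / N) ((one_lt_div hpos).2 hlt)
  have hn' : M / N < (f c / (N * p c)) ^ 2 ^ n :=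
    hn.trans_le (pow_le_pow_right₀ ((one_lt_div hpos).2 hlt).le Nat.lt_two_pow_self.le)
  rw [div_pow, div_lt_div_iff₀ hN (pow_pos hpos _)] at hn'
  linarith [key n c]

/-- The Stinespring space of a positive semidefinite map `φ`: a Hilbert space in which the vectors
`ε a h`, playing the role of `a ⊗ h`, are total. -/
theorem exists_stinespring_space {A : Type w} [Ring A] [StarRing A] [Algebra ℂ A] [StarModule ℂ A]
    {H : Type u} [NormedAddCommGroup H] [InnerProductSpace ℂ H] (φ : A →ₗ[ℂ] (H →ₗ[ℂ] H))
    (hφ : ∀ (n : ℕ) (a : Fin n → A) (h : Fin n → H),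
      0 ≤ ∑ i, ∑ j, ⟪h i, φ (star (a i) * a j) (h j)⟫_ℂ) :
    ∃ (E : Type (max u v w)) (_ : NormedAddCommGroup E) (_ : InnerProductSpace ℂ E)
      (_ : CompleteSpace E) (ε : A →ₗ[ℂ] H →ₗ[ℂ] E),
      (∀ a b h h', ⟪ε a h, ε b h'⟫_ℂ = ⟪h, φ (star a * b) h'⟫_ℂ) ∧
      (∀ f : E, (∀ a h, ⟪ε a h, f⟫_ℂ = 0) → f = 0) := by
  obtain ⟨E, i₁, i₂, i₃, e, he, hsep⟩ := exists_kolmogorov_decomposition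
    (X := ULift.{v} (A × H)) (fun x y => ⟪x.down.2, φ (star x.down.1 * y.down.1) y.down.2⟫_ℂ)
    (by
      intro s c
      have h := hφ s.card (fun i => (s.equivFin.symm i).1.down.1)
        (fun i => c (s.equivFin.symm i).1 • (s.equivFin.symm i).1.down.2)
      have hs (g : ULift.{v} (A × H) → ℂ) :
          ∑ i : Fin s.card, g (s.equivFin.symm i).1 = ∑ x ∈ s, g x := by
        rw [Equiv.sum_comp s.equivFin.symm (fun x : s => g x.1), Finset.sum_coe_sort s g]
      convert h using 1
      rw [← hs]
      refine Finset.sum_congr rfl fun i _ => ?_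
      rw [← hs]
      refine Finset.sum_congr rfl fun j _ => ?_
      simp only [map_smul, inner_smul_left, inner_smul_right, RCLike.star_def]
      ring)
  have ext {f g : E} (h : ∀ x, ⟪e x, f⟫_ℂ = ⟪e x, g⟫_ℂ) : f = g :=
    sub_eq_zero.1 (hsep _ fun x => by rw [inner_sub_right, h, sub_self])
  refine ⟨E, i₁, i₂, i₃, LinearMap.mk₂ ℂ (fun a h => e ⟨(a, h)⟩) ?_ ?_ ?_ ?_,
    fun a b h h' => he _ _, fun f hf => hsep f fun x => hf x.down.1 x.down.2⟩
  · intro a b h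
    refine ext fun x => ?_
    rw [inner_add_right]
    simp only [he, mul_add, map_add, LinearMap.add_apply, inner_add_right]
  · intro c a h
    refine ext fun x => ?_
    rw [inner_smul_right]
    simp only [he, mul_smul_comm, map_smul, LinearMap.smul_apply, inner_smul_right]
  · intro a h h'
    refine ext fun x => ?_
    rw [inner_add_right]
    simp only [he, map_add, inner_add_right]
  · intro c a h
    refine ext fun x => ?_
    rw [inner_smul_right]
    simp only [he, map_smul, inner_smul_right]

section StinespringSpace

variable {A : Type*} [Ring A] [Algebra ℂ A]
variable {H : Type*} [NormedAddCommGroup H] [InnerProductSpace ℂ H]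
variable {E : Type*} [NormedAddCommGroup E] [InnerProductSpace ℂ E]

/-- Pairs `(k, v)` such that `v` is the image of `k` under the formal adjoint of left
multiplication `ε a h ↦ ε (c * a) h`. -/
def adjointGraph (ε : A →ₗ[ℂ] H →ₗ[ℂ] E) (c : A) : Set (E × E) :=
  {t | ∀ a h, ⟪ε (c * a) h, t.1⟫_ℂ = ⟪ε a h, t.2⟫_ℂ}

/-- `v` is the image of `k` under the maximal extension of left multiplication
`ε a h ↦ ε (c * a) h`. -/
def IsLeftMul (ε : A →ₗ[ℂ] H →ₗ[ℂ] E) (c : A) (k v : E) : Prop :=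
  ∀ t ∈ adjointGraph ε c, ⟪t.2, k⟫_ℂ = ⟪t.1, v⟫_ℂ

/-- The span of the vectors `ε a h` with `h ∈ D`. -/
def stinespringSpan (ε : A →ₗ[ℂ] H →ₗ[ℂ] E) (D : Submodule ℂ H) : Submodule ℂ E :=
  ⨆ a, D.map (ε a)

variable {φ : A →ₗ[ℂ] (H →ₗ[ℂ] H)} {ε : A →ₗ[ℂ] H →ₗ[ℂ] E}

theorem mem_stinespringSpan (a : A) {D : Submodule ℂ H} {h : H} (hh : h ∈ D) :
    ε a h ∈ stinespringSpan ε D :=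
  Submodule.mem_iSup_of_mem a (Submodule.mem_map_of_mem hh)

theorem stinespringSpan_induction {D : Submodule ℂ H} {P : E → Prop}
    (hP : ∀ a, ∀ h ∈ D, P (ε a h)) (hadd : ∀ x y, P x → P y → P (x + y)) {k : E}
    (hk : k ∈ stinespringSpan ε D) : P k := by
  refine Submodule.iSup_induction _ (motive := P) hk ?_ ?_ hadd
  · rintro a _ ⟨h, hh, rfl⟩
    exact hP a h hh
  · simpa using hP 0 0 D.zero_mem

theorem stinespringSpan_mono {D D' : Submodule ℂ H} (h : D ≤ D') :
    stinespringSpan ε D ≤ stinespringSpan ε D' :=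
  iSup_mono fun _ => Submodule.map_mono h

theorem IsLeftMul.add {c : A} {k v k' v' : E} (h : IsLeftMul ε c k v) (h' : IsLeftMul ε c k' v') :
    IsLeftMul ε c (k + k') (v + v') := fun t ht => by
  rw [inner_add_right, inner_add_right, h t ht, h' t ht]

theorem isLeftMul_apply (c a : A) (h : H) : IsLeftMul ε c (ε a h) (ε (c * a) h) := fun t ht => by
  rw [← inner_conj_symm, ← ht a h, inner_conj_symm]

variable [StarRing A]

theorem IsLeftMul.inner_eq
    (hε : ∀ a b h h', ⟪ε a h, ε b h'⟫_ℂ = ⟪h, φ (star a * b) h'⟫_ℂ) {c : A} {k v : E}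
    (hkv : IsLeftMul ε c k v) (a : A) (h : H) : ⟪ε (star c * a) h, k⟫_ℂ = ⟪ε a h, v⟫_ℂ :=
  hkv (ε a h, ε (star c * a) h) fun b h' => by simp only [hε, star_mul, mul_assoc]

theorem IsLeftMul.inner_left_eq
    (hε : ∀ a b h h', ⟪ε a h, ε b h'⟫_ℂ = ⟪h, φ (star a * b) h'⟫_ℂ) {c : A} {k v k' v' : E}
    (h : IsLeftMul ε c k v) (h' : IsLeftMul ε (star c) k' v') : ⟪v, k'⟫_ℂ = ⟪k, v'⟫_ℂ := by
  rw [← inner_conj_symm, ← h (k', v') (fun a x => by simpa using h'.inner_eq hε a x),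
    inner_conj_symm]

theorem IsLeftMul.eq_of_inner_eq (hsep : ∀ f : E, (∀ a h, ⟪ε a h, f⟫_ℂ = 0) → f = 0)
    (hε : ∀ a b h h', ⟪ε a h, ε b h'⟫_ℂ = ⟪h, φ (star a * b) h'⟫_ℂ) {c : A} {k v v' : E}
    (h : IsLeftMul ε c k v) (h' : ∀ a x, ⟪ε (star c * a) x, k⟫_ℂ = ⟪ε a x, v'⟫_ℂ) : v = v' :=
  sub_eq_zero.1 (hsep _ fun a x => by rw [inner_sub_right, ← h.inner_eq hε, h', sub_self])

theorem IsLeftMul.unique (hsep : ∀ f : E, (∀ a h, ⟪ε a h, f⟫_ℂ = 0) → f = 0)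
    (hε : ∀ a b h h', ⟪ε a h, ε b h'⟫_ℂ = ⟪h, φ (star a * b) h'⟫_ℂ) {c : A} {k v v' : E}
    (h : IsLeftMul ε c k v) (h' : IsLeftMul ε c k v') : v = v' :=
  h.eq_of_inner_eq hsep hε (h'.inner_eq hε)

theorem norm_apply_le
    (hε : ∀ a b h h', ⟪ε a h, ε b h'⟫_ℂ = ⟪h, φ (star a * b) h'⟫_ℂ) {p : A → ℝ} {C : ℝ}
    (hp : ∀ a, 0 ≤ p a) (hpstar : ∀ a, p (star a * a) = p a ^ 2) {D : Submodule ℂ H}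
    (hφ : ∀ a, ∀ h ∈ D, ‖φ a h‖ ≤ C * p a * ‖h‖) (hC : 0 ≤ C) (a : A) {h : H} (hh : h ∈ D) :
    ‖ε a h‖ ≤ √C * p a * ‖h‖ := by
  refine le_of_sq_le_sq ?_ (by have := hp a; positivity)
  calc ‖ε a h‖ ^ 2 = ‖⟪ε a h, ε a h⟫_ℂ‖ := by
        rw [inner_self_eq_norm_sq_to_K]; simp
    _ ≤ ‖h‖ * ‖φ (star a * a) h‖ := by rw [hε]; exact norm_inner_le_norm _ _
    _ ≤ ‖h‖ * (C * p (star a * a) * ‖h‖) := by gcongr; exact hφ _ h hh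
    _ = (√C * p a * ‖h‖) ^ 2 := by rw [hpstar, mul_pow, mul_pow, Real.sq_sqrt hC]; ring

theorem exists_isLeftMul_of_mem_stinespringSpan
    (hε : ∀ a b h h', ⟪ε a h, ε b h'⟫_ℂ = ⟪h, φ (star a * b) h'⟫_ℂ) {p : A → ℝ} {C : ℝ}
    (hp : ∀ a, 0 ≤ p a) (hpmul : ∀ a b, p (a * b) ≤ p a * p b)
    (hpstar : ∀ a, p (star a * a) = p a ^ 2) {D : Submodule ℂ H}
    (hφ : ∀ a, ∀ h ∈ D, ‖φ a h‖ ≤ C * p a * ‖h‖) (hC : 0 ≤ C)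
    {k : E} (hk : k ∈ stinespringSpan ε D) (c : A) :
    ∃ v ∈ stinespringSpan ε D, IsLeftMul ε c k v ∧ ‖v‖ ≤ p c * ‖k‖ := by
  obtain ⟨V, M, hV1, hV, hVD, hVM⟩ : ∃ (V : A → E) (M : ℝ), V 1 = k ∧
      (∀ c d, IsLeftMul ε c (V d) (V (c * d))) ∧ (∀ c, V c ∈ stinespringSpan ε D) ∧
      ∀ c, ‖V c‖ ≤ M * p c := by
    refine stinespringSpan_induction (P := fun k => ∃ (V : A → E) (M : ℝ), V 1 = k ∧
      (∀ c d, IsLeftMul ε c (V d) (V (c * d))) ∧ (∀ c, V c ∈ stinespringSpan ε D) ∧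
      ∀ c, ‖V c‖ ≤ M * p c) ?_ ?_ hk
    · refine fun a h hh => ⟨fun c => ε (c * a) h, √C * p a * ‖h‖, by simp,
        fun c d => by simpa only [mul_assoc] using isLeftMul_apply c (d * a) h,
        fun c => mem_stinespringSpan _ hh, fun c => ?_⟩
      calc ‖ε (c * a) h‖ ≤ √C * p (c * a) * ‖h‖ := norm_apply_le hε hp hpstar hφ hC _ hh
        _ ≤ √C * (p c * p a) * ‖h‖ := by gcongr; exact hpmul _ _
        _ = √C * p a * ‖h‖ * p c := by ring
    · rintro x y ⟨V, M, hV1, hV, hVD, hVM⟩ ⟨V', M', hV1', hV', hVD', hVM'⟩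
      refine ⟨V + V', M + M', by simp [hV1, hV1'], fun c d => (hV c d).add (hV' c d),
        fun c => add_mem (hVD c) (hVD' c), fun c => ?_⟩
      rw [add_mul]
      exact (norm_add_le _ _).trans (add_le_add (hVM c) (hVM' c))
  have hVk (c : A) : IsLeftMul ε c k (V c) := by simpa [hV1] using hV c 1
  refine ⟨V c, hVD c, hVk c, ?_⟩
  rw [mul_comm]
  refine le_mul_of_sq_le_star_mul_self (f := fun c => ‖V c‖) hp hpstar (norm_nonneg k)
    hVM (fun c => ?_) c
  calc ‖V c‖ ^ 2 = ‖⟪V c, V c⟫_ℂ‖ := by rw [inner_self_eq_norm_sq_to_K]; simp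
    _ = ‖⟪k, V (star c * c)⟫_ℂ‖ := by rw [IsLeftMul.inner_left_eq hε (hVk c) (hV (star c) c)]
    _ ≤ ‖V (star c * c)‖ * ‖k‖ := by rw [mul_comm]; exact norm_inner_le_norm _ _

theorem exists_isLeftMul_of_mem_closure [CompleteSpace E]
    (hε : ∀ a b h h', ⟪ε a h, ε b h'⟫_ℂ = ⟪h, φ (star a * b) h'⟫_ℂ)
    (hsep : ∀ f : E, (∀ a h, ⟪ε a h, f⟫_ℂ = 0) → f = 0) {p : A → ℝ} {C : ℝ}
    (hp : ∀ a, 0 ≤ p a) (hpmul : ∀ a b, p (a * b) ≤ p a * p b)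
    (hpstar : ∀ a, p (star a * a) = p a ^ 2) {D : Submodule ℂ H}
    (hφ : ∀ a, ∀ h ∈ D, ‖φ a h‖ ≤ C * p a * ‖h‖) (hC : 0 ≤ C)
    {k : E} (hk : k ∈ (stinespringSpan ε D).topologicalClosure) (c : A) :
    ∃ v ∈ (stinespringSpan ε D).topologicalClosure, IsLeftMul ε c k v ∧ ‖v‖ ≤ p c * ‖k‖ := by
  have hspan {k : E} (hk : k ∈ stinespringSpan ε D) :=
    exists_isLeftMul_of_mem_stinespringSpan hε hp hpmul hpstar hφ hC hk c
  refine exists_adjoint_of_mem_topologicalClosure (adjointGraph ε c) (stinespringSpan ε D) _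
    (Submodule.isClosed_topologicalClosure _).isComplete (p c) (fun k hk => ?_) ?_ hk
  · obtain ⟨v, hv, hkv, -⟩ := hspan hk
    exact ⟨v, Submodule.le_topologicalClosure _ hv, hkv⟩
  · intro k hk v _ hkv
    obtain ⟨w, -, hkw, hw⟩ := hspan hk
    rwa [IsLeftMul.unique hsep hε (c := c) hkv hkw]

theorem exists_adjoint_apply_one
    (hε : ∀ a b h h', ⟪ε a h, ε b h'⟫_ℂ = ⟪h, φ (star a * b) h'⟫_ℂ) {D : Submodule ℂ H}
    (hD : IsComplete (D : Set H)) (hφD : ∀ a, ∀ h ∈ D, φ a h ∈ D) {B : ℝ} (hB0 : 0 ≤ B)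
    (hB : ∀ h ∈ D, ‖ε 1 h‖ ≤ B * ‖h‖) {k : E}
    (hk : k ∈ (stinespringSpan ε D).topologicalClosure) :
    ∃ v ∈ D, ∀ h, ⟪ε 1 h, k⟫_ℂ = ⟪h, v⟫_ℂ := by
  refine (exists_adjoint_of_mem_topologicalClosure (Set.range fun h => (h, ε 1 h))
    (stinespringSpan ε D) D hD B ?_ ?_ hk).imp
      fun v ⟨hv, hkv, _⟩ => ⟨hv, fun h => hkv _ ⟨h, rfl⟩⟩
  · refine fun k hk => stinespringSpan_induction (P := fun k => ∃ v ∈ D,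
      ∀ t ∈ Set.range fun h => (h, ε 1 h), ⟪t.2, k⟫_ℂ = ⟪t.1, v⟫_ℂ)
      (fun a h hh => ⟨φ a h, hφD a h hh, ?_⟩) ?_ hk
    · rintro _ ⟨h', rfl⟩
      simp [hε]
    · rintro x y ⟨v, hv, hxv⟩ ⟨w, hw, hyw⟩
      exact ⟨v + w, add_mem hv hw, fun t ht => by
        rw [inner_add_right, inner_add_right, hxv t ht, hyw t ht]⟩
  · intro k _ v hv hkv
    rcases eq_or_ne v 0 with rfl | hv0
    · simpa using mul_nonneg hB0 (norm_nonneg k)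
    refine le_of_mul_le_mul_left ?_ (norm_pos_iff.2 hv0)
    calc ‖v‖ * ‖v‖ = ‖⟪v, v⟫_ℂ‖ := by rw [inner_self_eq_norm_sq_to_K]; simp [sq]
      _ = ‖⟪ε 1 v, k⟫_ℂ‖ := by rw [hkv _ ⟨v, rfl⟩]
      _ ≤ ‖ε 1 v‖ * ‖k‖ := norm_inner_le_norm _ _
      _ ≤ B * ‖v‖ * ‖k‖ := by gcongr; exact hB v hv
      _ = ‖v‖ * (B * ‖k‖) := by ring

end StinespringSpace

/-- Stinespring theorem for continuous (noncoherent) completely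
positive maps: for a unital locally C*-algebra `A` with seminorms `(p_i)_{i∈I}` and a
locally Hilbert space `H = ⋃_{λ∈Λ} H_λ` (with `I` and `Λ` unrelated), a continuous
linear map `φ : A → B_loc(H)` is positive semidefinite iff `φ(a) = W* ∘ π(a) ∘ W` for
a continuous `*`-representation `π` of `A` on a locally Hilbert space `K` over `Λ`
and some `W ∈ B_loc(H,K)`. -/
theorem continuous_stinespring
    {I : Type y} [Preorder I] [Nonempty I] [IsDirected I (· ≤ ·)]
    {A : Type w} [Ring A] [StarRing A] [Algebra ℂ A] [StarModule ℂ A]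
    (pA : LocallyCStar I A)
    {Λ : Type v} [PartialOrder Λ] [Nonempty Λ] [IsDirected Λ (· ≤ ·)]
    {H : Type u} [NormedAddCommGroup H] [InnerProductSpace ℂ H]
    (hH : LocallyHilbert Λ H)
    (φ : A →ₗ[ℂ] (H →ₗ[ℂ] H))
    (hφlb : ∀ a : A, IsLocallyBounded hH hH (φ a))
    (hφcont : ∀ lam : Λ, ∃ (i : I) (C : ℝ), 0 ≤ C ∧
      ∀ (a : A), ∀ h ∈ hH.E lam, ‖φ a h‖ ≤ C * pA.p i a * ‖h‖) :
    (∀ (n : ℕ) (a : Fin n → A) (h : Fin n → H),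
        0 ≤ ∑ i, ∑ j, ⟪h i, φ (star (a i) * a j) (h j)⟫_ℂ) ↔
    (∃ (Kb : LocHilbertBundle.{max u v w y, v} Λ)
       (π : A →ₗ[ℂ] (Kb.carrier →ₗ[ℂ] Kb.carrier)) (W : H →ₗ[ℂ] Kb.carrier),
      (∀ a : A, IsLocallyBounded Kb.str Kb.str (π a)) ∧
      (∀ a b : A, π (a * b) = (π a) ∘ₗ (π b)) ∧
      (∀ a : A, IsLAdjoint (π a) (π (star a))) ∧
      (∀ lam : Λ, ∃ (i : I) (C : ℝ), 0 ≤ C ∧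
        ∀ (a : A), ∀ k ∈ Kb.str.E lam, ‖π a k‖ ≤ C * pA.p i a * ‖k‖) ∧
      IsLocallyBounded hH Kb.str W ∧
      (∀ (a : A) (h h' : H), ⟪h, φ a h'⟫_ℂ = ⟪W h, π a (W h')⟫_ℂ)) := by
  constructor
  · intro hpsd
    obtain ⟨E, _, _, _, ε, hε, hsep⟩ := exists_stinespring_space.{u, max v y, w} φ hpsd
    let M (lam : Λ) : Submodule ℂ E := (stinespringSpan ε (hH.E lam)).topologicalClosure
    have hM : Monotone M := fun _ _ h =>
      Submodule.topologicalClosure_mono (stinespringSpan_mono (hH.mono h))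
    have hMexists {k : E} : k ∈ ⨆ lam, M lam ↔ ∃ lam, k ∈ M lam :=
      Submodule.mem_iSup_of_directed _ hM.directed_le
    have hMmul (lam : Λ) : ∃ i, ∀ (c : A), ∀ k ∈ M lam,
        ∃ v ∈ M lam, IsLeftMul ε c k v ∧ ‖v‖ ≤ pA.p i c * ‖k‖ := by
      obtain ⟨i, C, hC, hφC⟩ := hφcont lam
      exact ⟨i, fun c k hk => exists_isLeftMul_of_mem_closure hε hsep (pA.nonneg i) (pA.mul_le i)
        (pA.cstar i) hφC hC hk c⟩
    let K : Submodule ℂ E := ⨆ lam, M lam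
    have hK (c : A) (k : K) : ∃ v : K, IsLeftMul ε c k v := by
      obtain ⟨lam, hk⟩ := hMexists.1 k.2
      obtain ⟨i, hi⟩ := hMmul lam
      obtain ⟨v, hv, hkv, -⟩ := hi c k hk
      exact ⟨⟨v, hMexists.2 ⟨lam, hv⟩⟩, hkv⟩
    choose P hP using hK
    have hPinner (c : A) (k : K) (a : A) (h : H) :
        ⟪ε a h, (P c k : E)⟫_ℂ = ⟪ε (star c * a) h, (k : E)⟫_ℂ := ((hP c k).inner_eq hε a h).symm
    have huniq {c : A} {k v : K} (h : ∀ a x, ⟪ε (star c * a) x, (k : E)⟫_ℂ = ⟪ε a x, (v : E)⟫_ℂ) :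
        P c k = v :=
      Subtype.ext ((hP c k).eq_of_inner_eq hsep hε h)
    have hPmem (lam : Λ) : ∃ i, ∀ (c : A) (k : K), (k : E) ∈ M lam →
        (P c k : E) ∈ M lam ∧ ‖P c k‖ ≤ pA.p i c * ‖k‖ := by
      obtain ⟨i, hi⟩ := hMmul lam
      refine ⟨i, fun c k hk => ?_⟩
      obtain ⟨v, hv, hkv, hle⟩ := hi c k hk
      have : (P c k : E) = v := IsLeftMul.unique hsep hε (hP c k) hkv
      exact ⟨this ▸ hv, by simpa [← this] using hle⟩
    let π : A →ₗ[ℂ] K →ₗ[ℂ] K := LinearMap.mk₂ ℂ P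
      (fun c d k => huniq fun a h => by
        simp [hPinner, add_mul])
      (fun z c k => huniq fun a h => by
        simp [hPinner, mul_comm])
      (fun c k k' => huniq fun a h => by simp [hPinner])
      (fun z c k => huniq fun a h => by simp [hPinner])
    have hπadj (a : A) : IsLAdjoint (π a) (π (star a)) := fun h k =>
      (hP a h).inner_left_eq hε (hP (star a) k)
    let Kstr : LocallyHilbert Λ K :=
      { E := fun lam => (M lam).comap K.subtype
        mono := fun _ _ h => Submodule.comap_mono (hM h)
        isComplete := fun lam => by
          rw [← isUniformEmbedding_subtype_val.isUniformInducing.isComplete_iff]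
          convert (Submodule.isClosed_topologicalClosure
            (stinespringSpan ε (hH.E lam))).isComplete using 1
          exact Subtype.image_preimage_coe _ _ |>.trans
            (Set.inter_eq_right.2 fun k hk => hMexists.2 ⟨lam, hk⟩)
        exhaustive := fun k => hMexists.1 k.2 }
    have hεK (a : A) (h : H) : ∃ lam, h ∈ hH.E lam ∧ ε a h ∈ M lam := by
      obtain ⟨lam, hh⟩ := hH.exhaustive h
      exact ⟨lam, hh, Submodule.le_topologicalClosure _ (mem_stinespringSpan a hh)⟩
    let W : H →ₗ[ℂ] K := (ε 1).codRestrict K fun h =>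
      let ⟨lam, _, hm⟩ := hεK 1 h
      hMexists.2 ⟨lam, hm⟩
    refine ⟨⟨K, Kstr⟩, π, W, fun a => ?_, fun a b => ?_, hπadj, fun lam => ?_, ?_, fun a h h' => ?_⟩
    · refine ⟨fun lam k hk => ?_, fun lam => ?_, fun lam k hk => ?_⟩
      · obtain ⟨i, hi⟩ := hPmem lam
        exact (hi a k hk).1
      · obtain ⟨i, hi⟩ := hPmem lam
        exact ⟨pA.p i a, fun k hk => (hi a k hk).2⟩
      · obtain ⟨i, hi⟩ := hPmem lam
        exact ⟨π (star a) k, (hi _ k hk).1, fun h => hπadj a h k⟩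
    · exact LinearMap.ext fun k => huniq fun x h => by simp [π, hPinner, mul_assoc]
    · obtain ⟨i, hi⟩ := hPmem lam
      exact ⟨i, 1, zero_le_one, fun a k hk => by rw [one_mul]; exact (hi a k hk).2⟩
    · have hW (lam : Λ) : ∃ B, 0 ≤ B ∧ ∀ h ∈ hH.E lam, ‖ε 1 h‖ ≤ B * ‖h‖ := by
        obtain ⟨i, C, hC, hφC⟩ := hφcont lam
        exact ⟨√C * pA.p i 1, mul_nonneg (Real.sqrt_nonneg _) (pA.nonneg i 1),
          fun h hh => norm_apply_le hε (pA.nonneg i) (pA.cstar i) hφC hC 1 hh⟩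
      refine ⟨fun lam h hh => ?_, fun lam => ?_, fun lam k hk => ?_⟩
      · exact Submodule.le_topologicalClosure _ (mem_stinespringSpan 1 hh)
      · obtain ⟨B, -, hB⟩ := hW lam
        exact ⟨B, hB⟩
      · obtain ⟨B, hB0, hB⟩ := hW lam
        exact exists_adjoint_apply_one hε (hH.isComplete lam)
          (fun a => (hφlb a).maps_mem lam) hB0 hB hk
    · have : (π a (W h') : E) = ε (a * 1) h' :=
        IsLeftMul.unique hsep hε (hP a (W h')) (isLeftMul_apply a 1 h')
      rw [Submodule.coe_inner, this]
      change _ = ⟪ε 1 h, ε (a * 1) h'⟫_ℂ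
      simp [hε]
  · rintro ⟨Kb, π, W, -, hmul, hadj, -, -, hφ⟩ n a h
    have : ∑ i, ∑ j, ⟪h i, φ (star (a i) * a j) (h j)⟫_ℂ =
        ⟪∑ i, π (a i) (W (h i)), ∑ i, π (a i) (W (h i))⟫_ℂ := by
      simp_rw [sum_inner, inner_sum]
      refine Finset.sum_congr rfl fun i _ => Finset.sum_congr rfl fun j _ => ?_
      rw [hφ, hmul, hadj, LinearMap.comp_apply]
    rw [this, inner_self_eq_norm_sq_to_K, ← RCLike.ofReal_pow]
    exact RCLike.ofReal_nonneg.2 (sq_nonneg _)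
end
end
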